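/- arXiv:2202.08764 — 5 statements merged into one kernel-verified Lean document; each statement's English description precedes it below -/
import Mathlib

section
/- If H is a P_4-free linear quadruple system on n vertices with exactly 5n/4 quadruples, then H is a vertex-disjoint union of copies of the Steiner system S(2,4,16); in particular every connected component of H is an S(2,4,16) on 16 vertices in which every vertex has degree 5. -/
/-- A linear quadruple system on vertex set `Fin n`: a 4-uniform hypergraph in which
every pair of vertices lies in at most one quadruple (equivalently, two distinct
quadruples share at most one vertex). -/
structure LinearQuadSystem (n : ℕ) where
  edges : Finset (Finset (Fin n))
  card_four : ∀ e ∈ edges, e.card = 4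
  linear : ∀ e ∈ edges, ∀ f ∈ edges, e ≠ f → (e ∩ f).card ≤ 1

/-- `H` contains the linear 4-path `P_k`: quadruples `e 0, …, e (k-1)` with consecutive
quadruples meeting in exactly one vertex and non-consecutive quadruples disjoint. -/
def ContainsPath {n : ℕ} (k : ℕ) (H : LinearQuadSystem n) : Prop :=
  ∃ e : Fin k → Finset (Fin n),
    (∀ i, e i ∈ H.edges) ∧
    (∀ i j : Fin k, (i : ℕ) + 1 = (j : ℕ) → (e i ∩ e j).card = 1) ∧
    (∀ i j : Fin k, (i : ℕ) + 2 ≤ (j : ℕ) → e i ∩ e j = ∅)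

namespace QuadSystem

open Finset

variable {α : Type*}

/-- A `P_4`-free linear quadruple system, given by its set of quadruples. -/
structure IsPathFree (E : Finset (Finset α)) : Prop where
  card_four : ∀ e ∈ E, #e = 4
  linear : ∀ e ∈ E, ∀ f ∈ E, ∀ x y, x ∈ e → x ∈ f → y ∈ e → y ∈ f → x ≠ y → e = f
  no_path : ∀ a ∈ E, ∀ b ∈ E, ∀ c ∈ E, ∀ d ∈ E, ¬ Disjoint a b → ¬ Disjoint b c →
    ¬ Disjoint c d → Disjoint a c → Disjoint a d → Disjoint b d → False

lemma IsPathFree.subset {E E' : Finset (Finset α)} (H : IsPathFree E) (hE : E' ⊆ E) :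
    IsPathFree E' where
  card_four e he := H.card_four e (hE he)
  linear e he f hf := H.linear e (hE he) f (hE hf)
  no_path a ha b hb c hc d hd := H.no_path a (hE ha) b (hE hb) c (hE hc) d (hE hd)

variable [DecidableEq α]

/-- The quadruples through a vertex. -/
def star (E : Finset (Finset α)) (v : α) : Finset (Finset α) := {e ∈ E | v ∈ e}

/-- The quadruples avoiding a vertex. -/
def away (E : Finset (Finset α)) (v : α) : Finset (Finset α) := {e ∈ E | v ∉ e}

/-- The quadruples through `v` that meet `h`. -/
def trace (E : Finset (Finset α)) (v : α) (h : Finset α) : Finset (Finset α) :=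
  {e ∈ star E v | ¬ Disjoint e h}

variable {E : Finset (Finset α)} {v : α} {e f g h : Finset α}

lemma mem_star : e ∈ star E v ↔ e ∈ E ∧ v ∈ e := by simp [star]

lemma mem_away : e ∈ away E v ↔ e ∈ E ∧ v ∉ e := by simp [away]

lemma mem_trace : e ∈ trace E v h ↔ e ∈ star E v ∧ ¬ Disjoint e h := by simp [trace]

lemma trace_subset : trace E v h ⊆ star E v := filter_subset _ _

namespace IsPathFree

lemma eq_of_mem_star (H : IsPathFree E) {x : α} (he : e ∈ star E v) (hf : f ∈ star E v)
    (hxe : x ∈ e) (hxf : x ∈ f) (hx : x ≠ v) : e = f := by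
  rw [mem_star] at he hf
  exact H.linear e he.1 f hf.1 x v hxe hxf he.2 hf.2 hx

/-- The trace of `h` is at most as large as any set of vertices of `h` through which it passes. -/
lemma card_trace_le (H : IsPathFree E) (hh : h ∈ away E v) {W : Finset α} (hWh : W ⊆ h)
    (hW : ∀ e ∈ trace E v h, ¬ Disjoint e W) : #(trace E v h) ≤ #W := by
  refine card_le_card_of_forall_subsingleton (fun e x => x ∈ e) (fun e he => ?_) ?_
  · obtain ⟨x, hxe, hxW⟩ := not_disjoint_iff.1 (hW e he)
    exact ⟨x, hxW, hxe⟩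
  · rintro x hx e ⟨he, hxe⟩ f ⟨hf, hxf⟩
    refine H.eq_of_mem_star (trace_subset he) (trace_subset hf) hxe hxf ?_
    rintro rfl
    exact (mem_away.1 hh).2 (hWh hx)

lemma card_trace_le_four (H : IsPathFree E) (hh : h ∈ away E v) : #(trace E v h) ≤ 4 :=
  (H.card_trace_le hh subset_rfl fun _ he => (mem_trace.1 he).2).trans_eq
    (H.card_four h (mem_away.1 hh).1)

lemma card_erase (H : IsPathFree E) (he : e ∈ star E v) : #(e.erase v) = 3 := by
  rw [card_erase_of_mem (mem_star.1 he).2, H.card_four e (mem_star.1 he).1]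

lemma exists_mem_erase (hh : h ∈ away E v) (hd : ¬ Disjoint e h) :
    ∃ x ∈ e.erase v, x ∈ h := by
  obtain ⟨x, hxe, hxh⟩ := not_disjoint_iff.1 hd
  refine ⟨x, mem_erase.2 ⟨?_, hxe⟩, hxh⟩
  rintro rfl
  exact (mem_away.1 hh).2 hxh

/-- At most three quadruples join a vertex `y` to a given quadruple through `v` outside `v`. -/
lemma card_le_three (H : IsPathFree E) {A : Finset (Finset α)} {y : α} (he : e ∈ star E v)
    (hy : y ∉ e) (hA : ∀ h ∈ A, h ∈ away E v ∧ y ∈ h ∧ ¬ Disjoint e h) : #A ≤ 3 := by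
  rw [← H.card_erase he]
  refine card_le_card_of_forall_subsingleton (fun h x => x ∈ h) (fun h hh => ?_) ?_
  · exact exists_mem_erase (hA h hh).1 (hA h hh).2.2
  · rintro x hx f ⟨hf, hxf⟩ g ⟨hg, hxg⟩
    refine H.linear f (mem_away.1 (hA f hf).1).1 g (mem_away.1 (hA g hg).1).1 x y hxf hxg
      (hA f hf).2.1 (hA g hg).2.1 ?_
    rintro rfl
    exact hy (mem_of_mem_erase hx)

/-- At most nine quadruples avoiding `v` meet two given quadruples through `v`. -/
lemma card_le_nine (H : IsPathFree E) {A : Finset (Finset α)} {e₁ e₂ : Finset α}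
    (h₁ : e₁ ∈ star E v) (h₂ : e₂ ∈ star E v) (hne : e₁ ≠ e₂)
    (hA : ∀ h ∈ A, h ∈ away E v ∧ ¬ Disjoint e₁ h ∧ ¬ Disjoint e₂ h) : #A ≤ 9 := by
  have hc : #(e₁.erase v ×ˢ e₂.erase v) = 9 := by
    rw [card_product, H.card_erase h₁, H.card_erase h₂]
  rw [← hc]
  refine card_le_card_of_forall_subsingleton (fun h p => p.1 ∈ h ∧ p.2 ∈ h) (fun h hh => ?_) ?_
  · obtain ⟨x, hx, hxh⟩ := exists_mem_erase (hA h hh).1 (hA h hh).2.1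
    obtain ⟨y, hy, hyh⟩ := exists_mem_erase (hA h hh).1 (hA h hh).2.2
    exact ⟨(x, y), mem_product.2 ⟨hx, hy⟩, hxh, hyh⟩
  · rintro ⟨x, y⟩ hxy f ⟨hf, hxf, hyf⟩ g ⟨hg, hxg, hyg⟩
    obtain ⟨hx, hy⟩ := mem_product.1 hxy
    refine H.linear f (mem_away.1 (hA f hf).1).1 g (mem_away.1 (hA g hg).1).1 x y hxf hxg
      hyf hyg ?_
    rintro rfl
    rw [mem_erase] at hx hy
    exact hne (H.eq_of_mem_star h₁ h₂ hx.2 hy.2 hx.1)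

/-- Quadruples with incomparable traces meet, and together they meet every quadruple
through `v`. -/
lemma meet_of_incomparable (H : IsPathFree E) (hf : f ∈ away E v) (hg : g ∈ away E v)
    {e e' : Finset α} (he : e ∈ trace E v f) (heg : e ∉ trace E v g)
    (he' : e' ∈ trace E v g) (hef' : e' ∉ trace E v f) :
    ¬ Disjoint f g ∧ star E v ⊆ trace E v f ∪ trace E v g := by
  have hmeet : ∀ {a b}, a ∈ star E v → b ∈ star E v → ¬ Disjoint a b := fun ha hb =>
    not_disjoint_iff.2 ⟨v, (mem_star.1 ha).2, (mem_star.1 hb).2⟩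
  rw [mem_trace] at he he'
  simp only [mem_trace, he.1, he'.1, true_and, not_not] at heg hef'
  have hfE := (mem_away.1 hf).1
  have hgE := (mem_away.1 hg).1
  have heE := (mem_star.1 he.1).1
  have heE' := (mem_star.1 he'.1).1
  have hfg : ¬ Disjoint f g := fun hd =>
    H.no_path f hfE e heE e' heE' g hgE (fun h => he.2 h.symm) (hmeet he.1 he'.1) he'.2
      hef'.symm hd heg
  refine ⟨hfg, fun a ha => ?_⟩
  by_contra hn
  simp only [mem_union, mem_trace, ha, true_and, not_or, not_not] at hn
  exact H.no_path g hgE f hfE e heE a (mem_star.1 ha).1 (fun h => hfg h.symm)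
    (fun h => he.2 h.symm) (hmeet he.1 ha) heg.symm hn.2.symm hn.1.symm

lemma card_cross_le_ten (H : IsPathFree E) {A B : Finset (Finset α)} {e₁ e₂ e₃ e₄ : Finset α}
    (h₁ : e₁ ∈ star E v) (h₂ : e₂ ∈ star E v) (h₁₂ : e₁ ≠ e₂)
    (h₃ : e₃ ∈ star E v) (h₄ : e₄ ∈ star E v) (h₃₄ : e₃ ≠ e₄)
    (hA : ∀ h ∈ A, h ∈ away E v ∧ ¬ Disjoint e₁ h ∧ ¬ Disjoint e₂ h)
    (hA' : ∀ h ∈ A, Disjoint e₃ h ∧ Disjoint e₄ h)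
    (hB : ∀ h ∈ B, h ∈ away E v ∧ ¬ Disjoint e₃ h ∧ ¬ Disjoint e₄ h)
    (hB' : ∀ h ∈ B, Disjoint e₁ h ∧ Disjoint e₂ h)
    (hAB : ∀ f ∈ A, ∀ g ∈ B, ¬ Disjoint f g) : #A + #B ≤ 10 := by
  have key : ∀ {e₁ e₂ : Finset α}, e₁ ∈ star E v → e₂ ∈ star E v → e₁ ≠ e₂ →
      ∀ g ∈ away E v, ¬ Disjoint e₁ g → ¬ Disjoint e₂ g → #(g \ (e₁ ∪ e₂)) ≤ 2 := by
    intro e₁ e₂ h₁ h₂ hne g hg hd₁ hd₂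
    obtain ⟨x, hx, hxg⟩ := exists_mem_erase hg hd₁
    obtain ⟨y, hy, hyg⟩ := exists_mem_erase hg hd₂
    rw [mem_erase] at hx hy
    have hxy : x ≠ y := by
      rintro rfl
      exact hne (H.eq_of_mem_star h₁ h₂ hx.2 hy.2 hx.1)
    have hsub : g \ (e₁ ∪ e₂) ⊆ (g.erase x).erase y := by
      intro z hz
      simp only [mem_sdiff, mem_union, not_or, mem_erase] at hz ⊢
      refine ⟨?_, ?_, hz.1⟩ <;> rintro rfl <;> tauto
    refine (card_le_card hsub).trans ?_
    rw [card_erase_of_mem (mem_erase.2 ⟨hxy.symm, hyg⟩), card_erase_of_mem hxg,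
      H.card_four g (mem_away.1 hg).1]
  have bound : ∀ {A : Finset (Finset α)} {g e₃ e₄ : Finset α} (m : ℕ),
      #(g \ (e₃ ∪ e₄)) ≤ 2 → (∀ f ∈ A, ¬ Disjoint f g) →
      (∀ f ∈ A, Disjoint e₃ f ∧ Disjoint e₄ f) →
      (∀ y ∈ g, #{f ∈ A | y ∈ f} ≤ m) → #A ≤ 2 * m := by
    intro A g e₃ e₄ m hg hfg hf hm
    have hsub : A ⊆ (g \ (e₃ ∪ e₄)).biUnion fun y => {f ∈ A | y ∈ f} := by
      intro f hfA
      obtain ⟨y, hyf, hyg⟩ := not_disjoint_iff.1 (hfg f hfA)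
      simp only [mem_biUnion, mem_sdiff, mem_union, not_or, mem_filter]
      exact ⟨y, ⟨hyg, fun h => disjoint_left.1 (hf f hfA).1 h hyf,
        fun h => disjoint_left.1 (hf f hfA).2 h hyf⟩, hfA, hyf⟩
    exact (card_le_card hsub).trans ((card_biUnion_le_card_mul _ _ m
      fun y hy => hm y (mem_sdiff.1 hy).1).trans (Nat.mul_le_mul_right m hg))
  rcases A.eq_empty_or_nonempty with rfl | ⟨f₀, hf₀⟩
  · have := H.card_le_nine h₃ h₄ h₃₄ hB
    simp only [card_empty]
    omega
  rcases B.eq_empty_or_nonempty with rfl | ⟨g₀, hg₀⟩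
  · have := H.card_le_nine h₁ h₂ h₁₂ hA
    simp only [card_empty]
    omega
  have hg2 : ∀ g ∈ B, #(g \ (e₃ ∪ e₄)) ≤ 2 := fun g hg =>
    key h₃ h₄ h₃₄ g (hB g hg).1 (hB g hg).2.1 (hB g hg).2.2
  have hB6 : #B ≤ 2 * 3 := by
    refine bound 3 (key h₁ h₂ h₁₂ f₀ (hA f₀ hf₀).1 (hA f₀ hf₀).2.1 (hA f₀ hf₀).2.2)
      (fun g hg h => hAB f₀ hf₀ g hg h.symm) hB' fun y hy => ?_
    refine H.card_le_three h₃ (fun h => disjoint_left.1 (hA' f₀ hf₀).1 h hy) fun g hg => ?_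
    rw [mem_filter] at hg
    exact ⟨(hB g hg.1).1, hg.2, (hB g hg.1).2.1⟩
  have hA6 : #A ≤ 2 * 3 := by
    refine bound 3 (hg2 g₀ hg₀) (fun f hf => hAB f hf g₀ hg₀) hA' fun y hy => ?_
    refine H.card_le_three h₁ (fun h => disjoint_left.1 (hB' g₀ hg₀).1 h hy) fun f hf => ?_
    rw [mem_filter] at hf
    exact ⟨(hA f hf.1).1, hf.2, (hA f hf.1).2.1⟩
  by_cases hy : ∀ y, #{f ∈ A | y ∈ f} ≤ 2
  · have := bound 2 (hg2 g₀ hg₀) (fun f hf => hAB f hf g₀ hg₀) hA' fun y _ => hy y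
    omega
  push Not at hy
  obtain ⟨y, hy⟩ := hy
  have hyB : ∀ g ∈ B, y ∈ g := by
    intro g hg
    by_contra hyg
    refine absurd ((hg2 g hg).trans_lt hy) (not_lt.2 ?_)
    refine card_le_card_of_forall_subsingleton (fun f x => x ∈ f) (fun f hf => ?_) ?_
    · have hfA := (mem_filter.1 hf).1
      obtain ⟨x, hxf, hxg⟩ := not_disjoint_iff.1 (hAB f hfA g hg)
      refine ⟨x, ?_, hxf⟩
      simp only [mem_sdiff, mem_union, not_or]
      exact ⟨hxg, fun h => disjoint_left.1 (hA' f hfA).1 h hxf,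
        fun h => disjoint_left.1 (hA' f hfA).2 h hxf⟩
    · rintro x hx f ⟨hf, hxf⟩ f' ⟨hf', hxf'⟩
      rw [mem_filter] at hf hf'
      refine H.linear f (mem_away.1 (hA f hf.1).1).1 f' (mem_away.1 (hA f' hf'.1).1).1 x y
        hxf hxf' hf.2 hf'.2 ?_
      rintro rfl
      exact hyg (mem_sdiff.1 hx).1
  obtain ⟨f, hf⟩ := card_pos.1 (by omega : 0 < #{f ∈ A | y ∈ f})
  rw [mem_filter] at hf
  have : #B ≤ 3 := H.card_le_three h₃ (fun h => disjoint_left.1 (hA' f hf.1).1 h hf.2)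
    fun g hg => ⟨(hB g hg).1, hyB g hg, (hB g hg).2.1⟩
  omega

end IsPathFree

/-- Every set of non-isolated vertices `X` meets at least `5 * #X / 4` quadruples. -/
def IsDense (E : Finset (Finset α)) : Prop :=
  ∀ X : Finset α, (∀ x ∈ X, ∃ e ∈ E, x ∈ e) → 5 * #X ≤ 4 * #{e ∈ E | ¬ Disjoint e X}

/-- A set of at least two quadruples through `v` that no trace splits. -/
structure IsAtom (E : Finset (Finset α)) (v : α) (C : Finset (Finset α)) : Prop where
  subset_star : C ⊆ star E v
  two_le_card : 2 ≤ #C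
  subset_or_disjoint : ∀ h ∈ away E v, C ⊆ trace E v h ∨ Disjoint C (trace E v h)

namespace IsPathFree

lemma isAtom_sdiff_trace (H : IsPathFree E) (hS : 6 ≤ #(star E v)) (hf : f ∈ away E v)
    (hmax : ∀ h ∈ away E v, trace E v f ⊆ trace E v h → trace E v h ⊆ trace E v f) :
    IsAtom E v (star E v \ trace E v f) where
  subset_star := sdiff_subset
  two_le_card := by
    have := H.card_trace_le_four hf
    rw [card_sdiff_of_subset trace_subset]
    omega
  subset_or_disjoint h hh := by
    by_cases h₁ : trace E v h ⊆ trace E v f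
    · exact Or.inr (disjoint_left.2 fun a ha ha' => (mem_sdiff.1 ha).2 (h₁ ha'))
    by_cases h₂ : trace E v f ⊆ trace E v h
    · exact absurd (hmax h hh h₂) h₁
    left
    obtain ⟨a, ha, ha'⟩ := not_subset.1 h₁
    obtain ⟨b, hb, hb'⟩ := not_subset.1 h₂
    intro c hc
    rw [mem_sdiff] at hc
    exact (mem_union.1 ((H.meet_of_incomparable hf hh hb hb' ha ha').2 hc.1)).resolve_left hc.2

lemma card_atoms_le_ten (H : IsPathFree E) {C D : Finset (Finset α)} (hC : IsAtom E v C)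
    (hD : IsAtom E v D) :
    #{h ∈ away E v | C ⊆ trace E v h ∧ Disjoint D (trace E v h)} +
      #{h ∈ away E v | D ⊆ trace E v h ∧ Disjoint C (trace E v h)} ≤ 10 := by
  obtain ⟨e₁, h₁, e₂, h₂, h₁₂⟩ := one_lt_card.1 hC.two_le_card
  obtain ⟨e₃, h₃, e₄, h₄, h₃₄⟩ := one_lt_card.1 hD.two_le_card
  have hmeet : ∀ {C h e}, C ⊆ trace E v h → e ∈ C → ¬ Disjoint e h := fun hCh he =>
    (mem_trace.1 (hCh he)).2
  have hdisj : ∀ {C h e}, IsAtom E v C → Disjoint C (trace E v h) → e ∈ C → Disjoint e h := by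
    intro C h e hC hCh he
    by_contra hd
    exact disjoint_left.1 hCh he (mem_trace.2 ⟨hC.subset_star he, hd⟩)
  refine H.card_cross_le_ten (hC.subset_star h₁) (hC.subset_star h₂) h₁₂ (hD.subset_star h₃)
    (hD.subset_star h₄) h₃₄ ?_ ?_ ?_ ?_ ?_ <;> simp only [mem_filter]
  · exact fun h hh => ⟨hh.1, hmeet hh.2.1 h₁, hmeet hh.2.1 h₂⟩
  · exact fun h hh => ⟨hdisj hD hh.2.2 h₃, hdisj hD hh.2.2 h₄⟩
  · exact fun h hh => ⟨hh.1, hmeet hh.2.1 h₃, hmeet hh.2.1 h₄⟩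
  · exact fun h hh => ⟨hdisj hC hh.2.2 h₁, hdisj hC hh.2.2 h₂⟩
  · exact fun f hf g hg => (H.meet_of_incomparable hf.1 hg.1 (hf.2.1 h₁)
      (disjoint_left.1 hg.2.2 h₁) (hg.2.1 h₃) (disjoint_left.1 hf.2.2 h₃)).1

lemma eleven_mul_card_le (H : IsPathFree E) (hE : IsDense E) {U : Finset (Finset α)}
    (hU : U ⊆ star E v) :
    11 * #U ≤ 4 * #{h ∈ away E v | ¬ Disjoint U (trace E v h)} := by
  have hcard : #(U.biUnion fun e => e.erase v) = #U * 3 := by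
    rw [card_biUnion, sum_const_nat]
    · exact fun e he => H.card_erase (hU he)
    · intro e he f hf hef
      refine disjoint_left.2 fun x hx hx' => hef ?_
      rw [mem_erase] at hx hx'
      exact H.eq_of_mem_star (hU he) (hU hf) hx.2 hx'.2 hx.1
  have hdense := hE (U.biUnion fun e => e.erase v) fun x hx => by
    obtain ⟨e, he, hxe⟩ := mem_biUnion.1 hx
    exact ⟨e, (mem_star.1 (hU he)).1, mem_of_mem_erase hxe⟩
  have hsub : {e ∈ E | ¬ Disjoint e (U.biUnion fun e => e.erase v)} ⊆
      U ∪ {h ∈ away E v | ¬ Disjoint U (trace E v h)} := by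
    intro h hh
    obtain ⟨hhE, hd⟩ := mem_filter.1 hh
    obtain ⟨x, hxh, hx⟩ := not_disjoint_iff.1 hd
    obtain ⟨e, he, hxe⟩ := mem_biUnion.1 hx
    rw [mem_erase] at hxe
    rw [mem_union]
    by_cases hv : v ∈ h
    · left
      rwa [← H.eq_of_mem_star (hU he) (mem_star.2 ⟨hhE, hv⟩) hxe.2 hxh hxe.1]
    · right
      exact mem_filter.2 ⟨mem_away.2 ⟨hhE, hv⟩, not_disjoint_iff.2
        ⟨e, he, mem_trace.2 ⟨hU he, not_disjoint_iff.2 ⟨x, hxe.2, hxh⟩⟩⟩⟩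
  have := (card_le_card hsub).trans (card_union_le _ _)
  omega

lemma exists_mem_trace (H : IsPathFree E) (hE : IsDense E) (he : e ∈ star E v) :
    ∃ h ∈ away E v, e ∈ trace E v h := by
  obtain ⟨x, hx⟩ := card_pos.1 (by rw [H.card_erase he]; norm_num : 0 < #(e.erase v))
  rw [mem_erase] at hx
  have hdense := hE {x} (by simpa using ⟨e, (mem_star.1 he).1, hx.2⟩)
  rw [card_singleton] at hdense
  obtain ⟨h, hh, hne⟩ := exists_mem_ne (by omega : 1 < #{f ∈ E | ¬ Disjoint f {x}}) e
  rw [mem_filter, disjoint_singleton_right, not_not] at hh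
  refine ⟨h, mem_away.2 ⟨hh.1, fun hv => hne ?_⟩,
    mem_trace.2 ⟨he, not_disjoint_iff.2 ⟨x, hx.2, hh.2⟩⟩⟩
  exact H.eq_of_mem_star (mem_star.2 ⟨hh.1, hv⟩) he hh.2 hx.2 hx.1

lemma card_star_le_five (H : IsPathFree E) (hE : IsDense E) (v : α) : #(star E v) ≤ 5 := by
  by_contra! hS
  obtain ⟨e₀, he₀⟩ := card_pos.1 (by omega : 0 < #(star E v))
  obtain ⟨h₀, hh₀, -⟩ := H.exists_mem_trace hE he₀
  obtain ⟨f₁, hf₁, hmax₁⟩ := exists_max_image (away E v) (fun h => #(trace E v h)) ⟨h₀, hh₀⟩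
  obtain ⟨i, hiS, hi⟩ := exists_mem_notMem_of_card_lt_card
    ((H.card_trace_le_four hf₁).trans_lt (by omega : 4 < #(star E v)))
  obtain ⟨h₁, hh₁, hih₁⟩ := H.exists_mem_trace hE hiS
  obtain ⟨f₂, hf₂, hmax₂⟩ := exists_max_image {h ∈ away E v | i ∈ trace E v h}
    (fun h => #(trace E v h)) ⟨h₁, mem_filter.2 ⟨hh₁, hih₁⟩⟩
  obtain ⟨hf₂, hif₂⟩ := mem_filter.1 hf₂
  have hC₁ := H.isAtom_sdiff_trace hS hf₁ fun h hh hs =>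
    (eq_of_subset_of_card_le hs (hmax₁ h hh)).superset
  have hC₂ := H.isAtom_sdiff_trace hS hf₂ fun h hh hs =>
    (eq_of_subset_of_card_le hs (hmax₂ h (mem_filter.2 ⟨hh, hs hif₂⟩))).superset
  have hdisj : Disjoint (star E v \ trace E v f₁) (star E v \ trace E v f₂) := by
    obtain ⟨j, hj, hj'⟩ := not_subset.1 fun hs : trace E v f₁ ⊆ trace E v f₂ =>
      hi (eq_of_subset_of_card_le hs (hmax₁ f₂ hf₂) ▸ hif₂)
    have hu := (H.meet_of_incomparable hf₁ hf₂ hj hj' hif₂ hi).2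
    refine disjoint_left.2 fun a ha ha' => ?_
    rw [mem_sdiff] at ha ha'
    have := mem_union.1 (hu ha.1)
    tauto
  generalize star E v \ trace E v f₁ = C₁ at hC₁ hdisj
  generalize star E v \ trace E v f₂ = C₂ at hC₂ hdisj
  have hU : #(C₁ ∪ C₂) = #C₁ + #C₂ := card_union_of_disjoint hdisj
  have h2₁ := hC₁.two_le_card
  have h2₂ := hC₂.two_le_card
  have h₁₂ := H.card_atoms_le_ten hC₁ hC₂
  by_cases hex : ∃ h ∈ away E v, C₁ ⊆ trace E v h ∧ C₂ ⊆ trace E v h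
  · obtain ⟨f₃, hf₃, hs₁, hs₂⟩ := hex
    have h4 := H.card_trace_le_four hf₃
    have heq : C₁ ∪ C₂ = trace E v f₃ :=
      eq_of_subset_of_card_le (union_subset hs₁ hs₂) (by omega)
    have hC₃ := H.isAtom_sdiff_trace hS hf₃ fun h hh hs =>
      (eq_of_subset_of_card_le hs (by
        have := H.card_trace_le_four hh
        rw [← heq]
        omega)).superset
    have hcov : C₁ ∪ C₂ ∪ (star E v \ trace E v f₃) = star E v := by
      rw [heq, union_sdiff_of_subset trace_subset]
    generalize star E v \ trace E v f₃ = C₃ at hC₃ hcov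
    have h₁₃ := H.card_atoms_le_ten hC₁ hC₃
    have h₂₃ := H.card_atoms_le_ten hC₂ hC₃
    have hbound := H.eleven_mul_card_le hE (subset_refl (star E v))
    have hpos : ∀ {C h}, IsAtom E v C → C ⊆ trace E v h → ¬ Disjoint C (trace E v h) := by
      intro C h hC hs hd
      have := hC.two_le_card
      rw [disjoint_self.1 (hd.mono_right hs)] at this
      simp at this
    have hsum : 2 * #{h ∈ away E v | ¬ Disjoint (star E v) (trace E v h)} ≤
        #{h ∈ away E v | C₁ ⊆ trace E v h ∧ Disjoint C₂ (trace E v h)} +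
        #{h ∈ away E v | C₂ ⊆ trace E v h ∧ Disjoint C₁ (trace E v h)} +
        (#{h ∈ away E v | C₁ ⊆ trace E v h ∧ Disjoint C₃ (trace E v h)} +
        #{h ∈ away E v | C₃ ⊆ trace E v h ∧ Disjoint C₁ (trace E v h)}) +
        (#{h ∈ away E v | C₂ ⊆ trace E v h ∧ Disjoint C₃ (trace E v h)} +
        #{h ∈ away E v | C₃ ⊆ trace E v h ∧ Disjoint C₂ (trace E v h)}) := by
      simp only [card_filter, ← sum_add_distrib, mul_sum]
      refine sum_le_sum fun h hh => ?_
      have h4' := H.card_trace_le_four hh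
      have hall : ¬ (C₁ ⊆ trace E v h ∧ C₂ ⊆ trace E v h ∧ C₃ ⊆ trace E v h) := fun hs => by
        have := card_le_card (union_subset (union_subset hs.1 hs.2.1) hs.2.2)
        rw [hcov] at this
        omega
      have hS' : Disjoint (star E v) (trace E v h) ↔ Disjoint C₁ (trace E v h) ∧
          Disjoint C₂ (trace E v h) ∧ Disjoint C₃ (trace E v h) := by
        rw [← hcov, disjoint_union_left, disjoint_union_left, and_assoc]
      have p₁ := hC₁.subset_or_disjoint h hh
      have p₂ := hC₂.subset_or_disjoint h hh
      have p₃ := hC₃.subset_or_disjoint h hh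
      have q₁ := hpos (h := h) hC₁
      have q₂ := hpos (h := h) hC₂
      have q₃ := hpos (h := h) hC₃
      simp only [hS']
      clear hS' hbound h₁₂ h₁₃ h₂₃ hmax₁ hmax₂
      by_cases r₁ : C₁ ⊆ trace E v h <;> by_cases r₂ : C₂ ⊆ trace E v h <;>
        by_cases r₃ : C₃ ⊆ trace E v h <;> simp_all
    omega
  · push Not at hex
    have hsub : {h ∈ away E v | ¬ Disjoint (C₁ ∪ C₂) (trace E v h)} ⊆
        {h ∈ away E v | C₁ ⊆ trace E v h ∧ Disjoint C₂ (trace E v h)} ∪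
        {h ∈ away E v | C₂ ⊆ trace E v h ∧ Disjoint C₁ (trace E v h)} := by
      intro h hh
      rw [mem_filter, disjoint_union_left] at hh
      simp only [mem_union, mem_filter]
      have := hex h hh.1
      have := hC₁.subset_or_disjoint h hh.1
      have := hC₂.subset_or_disjoint h hh.1
      tauto
    have hle := (card_le_card hsub).trans (card_union_le _ _)
    have hbound := H.eleven_mul_card_le hE (union_subset hC₁.subset_star hC₂.subset_star)
    omega

/-- Double counting of incidences between quadruples and vertices. -/
lemma sum_card_star (H : IsPathFree E) {V : Finset α} (hV : ∀ e ∈ E, e ⊆ V) :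
    ∑ v ∈ V, #(star E v) = 4 * #E := by
  have := sum_card_bipartiteAbove_eq_sum_card_bipartiteBelow (s := V) (t := E)
    (fun x e => x ∈ e)
  simp only [bipartiteAbove, bipartiteBelow] at this
  simp only [star]
  rw [this, mul_comm, sum_const_nat]
  intro e he
  rw [filter_mem_eq_inter, inter_eq_right.2 (hV e he), H.card_four e he]

lemma isDense {V : Finset α} (hV : ∀ e ∈ E, e ⊆ V)
    (hcard : 5 * #V ≤ 4 * #E)
    (hsub : ∀ W ⊂ V, ∀ E' ⊆ E, (∀ e ∈ E', e ⊆ W) → 4 * #E' ≤ 5 * #W) : IsDense E := by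
  intro X hX
  rcases X.eq_empty_or_nonempty with rfl | hne
  · simp
  have hXV : X ⊆ V := fun x hx => by
    obtain ⟨e, he, hxe⟩ := hX x hx
    exact hV e he hxe
  have hle := hsub (V \ X) (sdiff_ssubset hXV hne) {e ∈ E | Disjoint e X} (filter_subset _ _)
    fun e he => by
      rw [mem_filter] at he
      exact subset_sdiff.2 ⟨hV e he.1, he.2⟩
  have hsplit := card_filter_add_card_filter_not (s := E) (fun e => Disjoint e X)
  rw [card_sdiff_of_subset hXV] at hle
  have := card_le_card hXV
  omega

lemma four_mul_card_le (H : IsPathFree E) {V : Finset α} (hV : ∀ e ∈ E, e ⊆ V) :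
    4 * #E ≤ 5 * #V := by
  induction V using Finset.strongInduction generalizing E with
  | H V ih =>
    by_contra! hlt
    have hE := isDense hV hlt.le fun W hW _ hE' hE'W => ih W hW (H.subset hE') hE'W
    have := sum_le_card_nsmul V _ 5 fun v _ => H.card_star_le_five hE v
    rw [H.sum_card_star hV, smul_eq_mul] at this
    omega

lemma card_star_eq_five (H : IsPathFree E) {V : Finset α} (hV : ∀ e ∈ E, e ⊆ V)
    (hcard : 4 * #E = 5 * #V) : ∀ v ∈ V, #(star E v) = 5 := by
  have hE := isDense hV hcard.ge fun W _ E' hE' hE'W => (H.subset hE').four_mul_card_le hE'W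
  refine (sum_eq_sum_iff_of_le fun v _ => H.card_star_le_five hE v).1 ?_
  rw [H.sum_card_star hV, hcard, sum_const, smul_eq_mul, mul_comm]

lemma twelve_le_card (H : IsPathFree E) (hreg : ∀ v, #(star E v) = 5) (he : e ∈ star E v) :
    12 ≤ #{h ∈ away E v | e ∈ trace E v h} := by
  have hcard : #((e.erase v).biUnion fun x => (star E x).erase e) = #(e.erase v) * 4 := by
    rw [card_biUnion, sum_const_nat]
    · intro x hx
      rw [card_erase_of_mem (mem_star.2 ⟨(mem_star.1 he).1, mem_of_mem_erase hx⟩), hreg]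
    · intro x hx y hy hxy
      refine disjoint_left.2 fun f hf hf' => ?_
      rw [mem_erase, mem_star] at hf hf'
      exact hf.1 (H.linear f hf.2.1 e (mem_star.1 he).1 x y hf.2.2 (mem_of_mem_erase hx)
        hf'.2.2 (mem_of_mem_erase hy) hxy)
  rw [H.card_erase he] at hcard
  refine hcard.ge.trans (card_le_card fun f hf => ?_)
  obtain ⟨x, hx, hf⟩ := mem_biUnion.1 hf
  rw [mem_erase, mem_star] at hf
  rw [mem_erase] at hx
  exact mem_filter.2 ⟨mem_away.2 ⟨hf.2.1, fun hv =>
    hf.1 (H.eq_of_mem_star (mem_star.2 ⟨hf.2.1, hv⟩) he hf.2.2 hx.2 hx.1)⟩,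
    mem_trace.2 ⟨he, not_disjoint_iff.2 ⟨x, hx.2, hf.2.2⟩⟩⟩

lemma card_trace_ne_two (H : IsPathFree E) (hreg : ∀ v, #(star E v) = 5) (hf : f ∈ away E v) :
    #(trace E v f) ≠ 2 := by
  intro htwo
  have hthree : #(star E v \ trace E v f) = 3 := by
    rw [card_sdiff_of_subset trace_subset, hreg, htwo]
  obtain ⟨a, b, hab, htr⟩ := card_eq_two.1 htwo
  obtain ⟨c, d, e, hcd, hce, hde, hco⟩ := card_eq_three.1 hthree
  have ha : a ∈ trace E v f := by simp [htr]
  have hb : b ∈ trace E v f := by simp [htr]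
  have hc : c ∈ star E v \ trace E v f := by simp [hco]
  have hd : d ∈ star E v \ trace E v f := by simp [hco]
  have he : e ∈ star E v \ trace E v f := by simp [hco]
  rw [mem_sdiff] at hc hd he
  have hnine : ∀ {p q} {A : Finset (Finset α)}, p ∈ star E v → q ∈ star E v → p ≠ q →
      (∀ g ∈ A, g ∈ away E v ∧ p ∈ trace E v g ∧ q ∈ trace E v g) → #A ≤ 9 :=
    fun hp hq hpq hA => H.card_le_nine hp hq hpq fun g hg =>
      ⟨(hA g hg).1, (mem_trace.1 (hA g hg).2.1).2, (mem_trace.1 (hA g hg).2.2).2⟩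
  have hdisj : ∀ g ∈ away E v, a ∈ trace E v g → b ∈ trace E v g → c ∈ trace E v g →
      d ∈ trace E v g → e ∈ trace E v g → False := by
    intro g hg ga gb gc gd ge
    have hsub : star E v ⊆ trace E v g := by
      rw [← union_sdiff_of_subset (trace_subset (h := f)), hco, htr]
      simp [insert_subset_iff, ga, gb, gc, gd, ge]
    have hle := card_le_card hsub
    have := H.card_trace_le_four hg
    rw [hreg] at hle
    omega
  have hdich : ∀ {p}, p ∈ star E v → p ∉ trace E v f → ∀ g ∈ away E v, p ∈ trace E v g →
      (a ∈ trace E v g ∧ b ∈ trace E v g) ∨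
        (c ∈ trace E v g ∧ d ∈ trace E v g ∧ e ∈ trace E v g) := by
    intro p hp hpf g hg hpg
    by_contra hn
    have hex : ∃ q ∈ trace E v f, q ∉ trace E v g := by
      by_contra! hall
      exact hn (Or.inl ⟨hall a ha, hall b hb⟩)
    obtain ⟨q, hq, hqg⟩ := hex
    have hu := (H.meet_of_incomparable hf hg hq hqg hpg hpf).2
    exact hn (Or.inr ⟨(mem_union.1 (hu hc.1)).resolve_left hc.2,
      (mem_union.1 (hu hd.1)).resolve_left hd.2, (mem_union.1 (hu he.1)).resolve_left he.2⟩)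
  obtain ⟨Q, hQ⟩ : ∃ Q : Finset (Finset α), ∀ g, g ∈ Q ↔
      g ∈ away E v ∧ a ∈ trace E v g ∧ b ∈ trace E v g :=
    ⟨{g ∈ away E v | a ∈ trace E v g ∧ b ∈ trace E v g}, fun g => mem_filter⟩
  obtain ⟨R, hR⟩ : ∃ R : Finset (Finset α), ∀ g, g ∈ R ↔
      g ∈ away E v ∧ c ∈ trace E v g ∧ d ∈ trace E v g ∧ e ∈ trace E v g :=
    ⟨{g ∈ away E v | c ∈ trace E v g ∧ d ∈ trace E v g ∧ e ∈ trace E v g}, fun g => mem_filter⟩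
  have hQR : ∀ {p}, p ∈ star E v → p ∉ trace E v f →
      12 ≤ #{g ∈ Q | p ∈ trace E v g} + #R := by
    intro p hp hpf
    refine (H.twelve_le_card hreg hp).trans ((card_le_card fun g hg => ?_).trans
      (card_union_le _ _))
    rw [mem_filter] at hg
    have := hdich hp hpf g hg.1 hg.2
    simp only [mem_union, hQ, hR, mem_filter]
    tauto
  have hpair : ∀ {p q}, p ∈ star E v → q ∈ star E v → p ≠ q →
      (∀ g ∈ R, p ∈ trace E v g ∧ q ∈ trace E v g) →
      #({g ∈ Q | p ∈ trace E v g} ∩ {g ∈ Q | q ∈ trace E v g}) + #R ≤ 9 := by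
    intro p q hp hq hpq hpqR
    rw [← card_union_of_disjoint]
    · refine hnine hp hq hpq fun g hg => ?_
      rcases mem_union.1 hg with hg | hg
      · simp only [mem_inter, mem_filter, hQ] at hg
        tauto
      · exact ⟨((hR g).1 hg).1, hpqR g hg⟩
    · refine disjoint_left.2 fun g hg hg' => ?_
      simp only [mem_inter, mem_filter, hQ, hR] at hg hg'
      exact hdisj g hg'.1 hg.1.1.2.1 hg.1.1.2.2 hg'.2.1 hg'.2.2.1 hg'.2.2.2
  have hc12 := hQR hc.1 hc.2
  have hd12 := hQR hd.1 hd.2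
  have he12 := hQR he.1 he.2
  have hRm : ∀ g ∈ R, c ∈ trace E v g ∧ d ∈ trace E v g ∧ e ∈ trace E v g := fun g hg =>
    ((hR g).1 hg).2
  have hcd9 := hpair hc.1 hd.1 hcd fun g hg => ⟨(hRm g hg).1, (hRm g hg).2.1⟩
  have hce9 := hpair hc.1 he.1 hce fun g hg => ⟨(hRm g hg).1, (hRm g hg).2.2⟩
  have hde9 := hpair hd.1 he.1 hde fun g hg => ⟨(hRm g hg).2.1, (hRm g hg).2.2⟩
  have hQ9 : #Q ≤ 9 := hnine (trace_subset ha) (trace_subset hb) hab fun g hg =>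
    (hQ g).1 hg
  have hlt : #({g ∈ Q | c ∈ trace E v g} ∪ {g ∈ Q | d ∈ trace E v g} ∪
      {g ∈ Q | e ∈ trace E v g}) < #Q := by
    refine card_lt_card ((ssubset_iff_of_subset ?_).2 ⟨f, (hQ f).2 ⟨hf, ha, hb⟩, ?_⟩)
    · exact union_subset (union_subset (filter_subset _ _) (filter_subset _ _))
        (filter_subset _ _)
    · simp only [mem_union, mem_filter]
      tauto
  have hu₁ := card_union_add_card_inter {g ∈ Q | c ∈ trace E v g} {g ∈ Q | d ∈ trace E v g}
  have hu₂ := card_union_add_card_inter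
    ({g ∈ Q | c ∈ trace E v g} ∪ {g ∈ Q | d ∈ trace E v g}) {g ∈ Q | e ∈ trace E v g}
  rw [union_inter_distrib_right] at hu₂
  have hu₃ := card_union_le ({g ∈ Q | c ∈ trace E v g} ∩ {g ∈ Q | e ∈ trace E v g})
    ({g ∈ Q | d ∈ trace E v g} ∩ {g ∈ Q | e ∈ trace E v g})
  omega

/-- In a 5-regular system, a quadruple meeting the closed neighbourhood of `v` stays inside. -/
lemma exists_mem_star_of_mem (H : IsPathFree E) (hreg : ∀ v, #(star E v) = 5)
    (hf : f ∈ away E v) (hne : (trace E v f).Nonempty) {x : α} (hx : x ∈ f) :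
    ∃ e ∈ star E v, x ∈ e := by
  by_contra! hout
  have haway : ∀ g ∈ star E x, g ∈ away E v := fun g hg =>
    mem_away.2 ⟨(mem_star.1 hg).1, fun hv =>
      hout g (mem_star.2 ⟨(mem_star.1 hg).1, hv⟩) (mem_star.1 hg).2⟩
  have hle : ∀ g ∈ star E x, #(trace E v g) ≤ 3 := by
    intro g hg
    rw [← H.card_erase hg]
    refine H.card_trace_le (haway g hg) (erase_subset _ _) fun e he => ?_
    obtain ⟨y, hye, hyg⟩ := not_disjoint_iff.1 (mem_trace.1 he).2
    refine not_disjoint_iff.2 ⟨y, hye, mem_erase.2 ⟨?_, hyg⟩⟩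
    rintro rfl
    exact hout e (trace_subset he) hye
  have hfx : f ∈ star E x := mem_star.2 ⟨(mem_away.1 hf).1, hx⟩
  have hpos : ∀ g ∈ star E x, (trace E v g).Nonempty := by
    intro g hg
    rw [nonempty_iff_ne_empty]
    intro h0
    obtain ⟨e, he⟩ := hne
    obtain ⟨e', he', hef'⟩ := exists_mem_notMem_of_card_lt_card
      ((hle f hfx).trans_lt (by rw [hreg]; norm_num : 3 < #(star E v)))
    have hdisj : ∀ a ∈ star E v, Disjoint a g := fun a ha => by
      by_contra hd
      exact notMem_empty a (h0 ▸ mem_trace.2 ⟨ha, hd⟩)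
    rw [mem_trace] at he
    refine H.no_path g (mem_star.1 hg).1 f (mem_star.1 hfx).1 e (mem_star.1 he.1).1 e'
      (mem_star.1 he').1 (not_disjoint_iff.2 ⟨x, (mem_star.1 hg).2, hx⟩) (fun h => he.2 h.symm)
      (not_disjoint_iff.2 ⟨v, (mem_star.1 he.1).2, (mem_star.1 he').2⟩) (hdisj e he.1).symm
      (hdisj e' he').symm ?_
    by_contra hd
    exact hef' (mem_trace.2 ⟨he', fun h => hd h.symm⟩)
  have hcomp : ∀ g ∈ star E x, ∀ h ∈ star E x, trace E v g ⊆ trace E v h ∨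
      trace E v h ⊆ trace E v g ∨ star E v ⊆ trace E v g ∪ trace E v h := by
    intro g hg h hh
    by_contra! hn
    obtain ⟨a, ha, ha'⟩ := not_subset.1 hn.1
    obtain ⟨b, hb, hb'⟩ := not_subset.1 hn.2.1
    exact hn.2.2 (H.meet_of_incomparable (haway g hg) (haway h hh) ha ha' hb hb').2
  have hcommon : ∀ e ∈ star E v, ∃ g ∈ star E x, e ∉ trace E v g := by
    intro e he
    by_contra! hall
    have := H.card_le_three (A := star E x) he (hout e he) fun g hg =>
      ⟨haway g hg, (mem_star.1 hg).2, (mem_trace.1 (hall g hg)).2⟩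
    rw [hreg] at this
    omega
  have hthree : ∀ g ∈ star E x, #(trace E v g) = 3 := by
    intro g hg
    have h1 := card_pos.2 (hpos g hg)
    have h2 := H.card_trace_ne_two hreg (haway g hg)
    have h3 := hle g hg
    by_contra hn
    obtain ⟨a, ha⟩ := card_eq_one.1 (by omega : #(trace E v g) = 1)
    obtain ⟨h, hh, hah⟩ := hcommon a (trace_subset (h := g) (by simp [ha]))
    rcases hcomp g hg h hh with hs | hs | hs
    · exact hah (hs (by simp [ha]))
    · obtain ⟨b, hb⟩ := hpos h hh
      have hba := hs hb
      rw [ha, mem_singleton] at hba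
      exact hah (hba ▸ hb)
    · have hs' := (card_le_card hs).trans (card_union_le _ _)
      have := hle h hh
      rw [hreg, ha, card_singleton] at hs'
      omega
  have hunion : ∀ g ∈ star E x, ∀ h ∈ star E x, trace E v g ≠ trace E v h →
      star E v ⊆ trace E v g ∪ trace E v h := by
    intro g hg h hh hgh
    rcases hcomp g hg h hh with hs | hs | hs
    · exact absurd (eq_of_subset_of_card_le hs (by rw [hthree g hg, hthree h hh])) hgh
    · exact absurd (eq_of_subset_of_card_le hs (by rw [hthree g hg, hthree h hh])).symm hgh
    · exact hs
  obtain ⟨a, ha⟩ := hne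
  obtain ⟨g, hg, hag⟩ := hcommon a (trace_subset ha)
  have hfg := hunion f hfx g hg fun h => hag (h ▸ ha)
  have hui := card_union_add_card_inter (trace E v f) (trace E v g)
  have hu5 : #(trace E v f ∪ trace E v g) ≤ 5 := by
    rw [← hreg v]
    exact card_le_card (union_subset trace_subset trace_subset)
  rw [hthree f hfx, hthree g hg] at hui
  obtain ⟨i, hi⟩ := card_pos.1 (by omega : 0 < #(trace E v f ∩ trace E v g))
  rw [mem_inter] at hi
  obtain ⟨k, hk, hik⟩ := hcommon i (trace_subset hi.1)
  have hfk := hunion f hfx k hk fun h => hik (h ▸ hi.1)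
  have hgk := hunion g hg k hk fun h => hik (h ▸ hi.2)
  have hsub : (star E v \ trace E v f) ∪ (star E v \ trace E v g) ⊆ trace E v k := by
    refine union_subset (fun b hb => ?_) fun b hb => ?_ <;> rw [mem_sdiff] at hb
    · exact (mem_union.1 (hfk hb.1)).resolve_left hb.2
    · exact (mem_union.1 (hgk hb.1)).resolve_left hb.2
  have hd : Disjoint (star E v \ trace E v f) (star E v \ trace E v g) := by
    refine disjoint_left.2 fun b hb hb' => ?_
    rw [mem_sdiff] at hb hb'
    have := mem_union.1 (hfg hb.1)
    tauto
  have hc := card_le_card hsub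
  rw [card_union_of_disjoint hd, card_sdiff_of_subset trace_subset,
    card_sdiff_of_subset trace_subset, hreg, hthree f hfx, hthree g hg, hthree k hk] at hc
  omega

end IsPathFree

/-- The union of the quadruples through `v`. -/
def closedNbhd (E : Finset (Finset α)) (v : α) : Finset α := (star E v).biUnion id

lemma mem_closedNbhd {x : α} : x ∈ closedNbhd E v ↔ ∃ e ∈ star E v, x ∈ e := by
  simp [closedNbhd]

lemma subset_closedNbhd (he : e ∈ E) (hv : v ∈ e) : e ⊆ closedNbhd E v := fun _ hx =>
  mem_closedNbhd.2 ⟨e, mem_star.2 ⟨he, hv⟩, hx⟩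

namespace IsPathFree

lemma self_mem_closedNbhd (hreg : ∀ v, #(star E v) = 5) (v : α) : v ∈ closedNbhd E v := by
  obtain ⟨e, he⟩ := card_pos.1 (by rw [hreg]; norm_num : 0 < #(star E v))
  exact mem_closedNbhd.2 ⟨e, he, (mem_star.1 he).2⟩

lemma card_closedNbhd (H : IsPathFree E) (hreg : ∀ v, #(star E v) = 5) (v : α) :
    #(closedNbhd E v) = 16 := by
  have herase : (closedNbhd E v).erase v = (star E v).biUnion fun e => e.erase v := by
    ext x
    simp only [mem_erase, mem_closedNbhd, mem_biUnion]
    grind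
  have hcard : #((closedNbhd E v).erase v) = #(star E v) * 3 := by
    rw [herase, card_biUnion, sum_const_nat]
    · exact fun e he => H.card_erase he
    · intro e he f hf hef
      refine disjoint_left.2 fun x hx hx' => hef ?_
      rw [mem_erase] at hx hx'
      exact H.eq_of_mem_star he hf hx.2 hx'.2 hx.1
  have := card_erase_add_one (self_mem_closedNbhd hreg v)
  rw [hreg] at hcard
  omega

lemma closedNbhd_eq (H : IsPathFree E) (hreg : ∀ v, #(star E v) = 5) {x : α}
    (hx : x ∈ closedNbhd E v) : closedNbhd E x = closedNbhd E v := by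
  refine eq_of_subset_of_card_le (fun y hy => ?_)
    (by rw [H.card_closedNbhd hreg, H.card_closedNbhd hreg])
  obtain ⟨f, hf, hyf⟩ := mem_closedNbhd.1 hy
  obtain ⟨e, he, hxe⟩ := mem_closedNbhd.1 hx
  rw [mem_star] at hf
  by_cases hv : v ∈ f
  · exact subset_closedNbhd hf.1 hv hyf
  · exact mem_closedNbhd.2 (H.exists_mem_star_of_mem hreg (mem_away.2 ⟨hf.1, hv⟩)
      ⟨e, mem_trace.2 ⟨he, not_disjoint_iff.2 ⟨x, hxe, hf.2⟩⟩⟩ hyf)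

end IsPathFree

lemma isPathFree_edges {n : ℕ} (H : LinearQuadSystem n) (hfree : ¬ ContainsPath 4 H) :
    IsPathFree H.edges where
  card_four := H.card_four
  linear e he f hf x y hxe hxf hye hyf hxy := by
    by_contra hef
    exact absurd (H.linear e he f hf hef) (not_le.2 (one_lt_card.2
      ⟨x, mem_inter.2 ⟨hxe, hxf⟩, y, mem_inter.2 ⟨hye, hyf⟩, hxy⟩))
  no_path a ha b hb c hc d hd hab hbc hcd hac had hbd := by
    have hone : ∀ e ∈ H.edges, ∀ f ∈ H.edges, e ≠ f → ¬ Disjoint e f → #(e ∩ f) = 1 := by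
      intro e he f hf hef hd
      have := H.linear e he f hf hef
      have := card_pos.2 (not_disjoint_iff_nonempty_inter.1 hd)
      omega
    have h₁ := hone a ha b hb (by rintro rfl; exact hbc hac) hab
    have h₂ := hone b hb c hc (by rintro rfl; exact hcd hbd) hbc
    have h₃ := hone c hc d hd (by rintro rfl; exact hbc hbd) hcd
    rw [disjoint_iff_inter_eq_empty] at hac had hbd
    refine hfree ⟨![a, b, c, d], ?_, ?_, ?_⟩
    · intro i
      fin_cases i <;> assumption
    · intro i j hij
      fin_cases i <;> fin_cases j <;> first | assumption | simp at hij
    · intro i j hij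
      fin_cases i <;> fin_cases j <;> first | assumption | simp at hij

end QuadSystem

/-- a `P_4`-free linear quadruple system on `n` vertices with exactly
`5n/4` quadruples (i.e. `4 · |E(H)| = 5n`) is a vertex-disjoint union of copies of the
Steiner system `S(2,4,16)`: the vertex set splits into pairwise disjoint 16-element
classes, every quadruple lies inside one class, within each class every pair of
vertices lies in exactly one quadruple of `H`, and every vertex has degree 5. -/
theorem linear_turan_P4_extremal (n : ℕ) (H : LinearQuadSystem n)
    (hfree : ¬ ContainsPath 4 H) (hcard : 4 * H.edges.card = 5 * n) :
    ∃ P : Finset (Finset (Fin n)),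
      (∀ A ∈ P, A.card = 16) ∧
      (∀ A ∈ P, ∀ B ∈ P, A ≠ B → Disjoint A B) ∧
      P.biUnion id = Finset.univ ∧
      (∀ e ∈ H.edges, ∃ A ∈ P, e ⊆ A) ∧
      (∀ A ∈ P, ∀ x ∈ A, ∀ y ∈ A, x ≠ y →
        ∃! e : Finset (Fin n), e ∈ H.edges ∧ e ⊆ A ∧ x ∈ e ∧ y ∈ e) ∧
      (∀ v : Fin n, (H.edges.filter (fun e => v ∈ e)).card = 5) := by
  have hE := QuadSystem.isPathFree_edges H hfree
  have hreg : ∀ v, (QuadSystem.star H.edges v).card = 5 := fun v =>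
    hE.card_star_eq_five (V := Finset.univ) (fun e _ => Finset.subset_univ e)
      (by rw [hcard, Finset.card_univ, Fintype.card_fin]) v (Finset.mem_univ v)
  refine ⟨Finset.univ.image (QuadSystem.closedNbhd H.edges), ?_, ?_, ?_, ?_, ?_, hreg⟩
  · simp only [Finset.mem_image, Finset.mem_univ, true_and, forall_exists_index,
      forall_apply_eq_imp_iff]
    exact hE.card_closedNbhd hreg
  · simp only [Finset.mem_image, Finset.mem_univ, true_and, forall_exists_index,
      forall_apply_eq_imp_iff]
    intro v w hne
    refine Finset.disjoint_left.2 fun x hxv hxw => hne ?_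
    rw [← hE.closedNbhd_eq hreg hxv, hE.closedNbhd_eq hreg hxw]
  · refine Finset.eq_univ_iff_forall.2 fun v => Finset.mem_biUnion.2
      ⟨QuadSystem.closedNbhd H.edges v, Finset.mem_image_of_mem _ (Finset.mem_univ v), ?_⟩
    exact QuadSystem.IsPathFree.self_mem_closedNbhd hreg v
  · intro e he
    obtain ⟨v, hv⟩ := Finset.card_pos.1 (by rw [H.card_four e he]; norm_num : 0 < e.card)
    exact ⟨_, Finset.mem_image_of_mem _ (Finset.mem_univ v), QuadSystem.subset_closedNbhd he hv⟩
  · simp only [Finset.mem_image, Finset.mem_univ, true_and, forall_exists_index,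
      forall_apply_eq_imp_iff]
    intro v x hx y hy hxy
    rw [← hE.closedNbhd_eq hreg hx] at hy ⊢
    obtain ⟨e, he, hye⟩ := QuadSystem.mem_closedNbhd.1 hy
    rw [QuadSystem.mem_star] at he
    exact ⟨e, ⟨he.1, QuadSystem.subset_closedNbhd he.1 he.2, he.2, hye⟩, fun f hf =>
      hE.linear f hf.1 e he.1 x y hf.2.2.1 he.2 hf.2.2.2 hye hxy⟩
end

section
/- For n ≥ 4, ex^lin_4(n, E_4^+) ≥ 12·⌊(n−4)/9⌋ + ε, where ε = 0 if n−4 ≡ 0, 1 or 2 (mod 9), ε = 1 if n−4 ≡ 3 or 4 (mod 9), ε = 2 if n−4 ≡ 5 (mod 9), ε = 4 if n−4 ≡ 6 (mod 9), ε = 5 if n−4 ≡ 7 (mod 9), and ε = 8 if n−4 ≡ 8 (mod 9). That is, there exists an E_4^+-free linear quadruple system on n vertices with at least 12·⌊(n−4)/9⌋ + ε quadruples. -/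
/-- `H` contains `E_4^+`: three pairwise disjoint quadruples `e₁, e₂, e₃` together
with a fourth quadruple `f` meeting each of them in exactly one vertex. -/
def ContainsE4plus {n : ℕ} (H : LinearQuadSystem n) : Prop :=
  ∃ e₁ e₂ e₃ f : Finset (Fin n),
    e₁ ∈ H.edges ∧ e₂ ∈ H.edges ∧ e₃ ∈ H.edges ∧ f ∈ H.edges ∧
    Disjoint e₁ e₂ ∧ Disjoint e₁ e₃ ∧ Disjoint e₂ e₃ ∧
    (f ∩ e₁).card = 1 ∧ (f ∩ e₂).card = 1 ∧ (f ∩ e₃).card = 1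

/-- The correction term `ε` depending on `n - 4` modulo 9. -/
def eps (n : ℕ) : ℕ :=
  if (n - 4) % 9 ≤ 2 then 0
  else if (n - 4) % 9 ≤ 4 then 1
  else if (n - 4) % 9 = 5 then 2
  else if (n - 4) % 9 = 6 then 4
  else if (n - 4) % 9 = 7 then 5
  else 8

/-- Quadruples of natural numbers below `n`, pairwise sharing at most one point, each having exactly
one point in the core `{0, 1, 2, 3}`, such that two quadruples meeting a common quadruple outside
the core always meet each other. -/
structure IsCoreSystem (n : ℕ) (E : Finset (Finset ℕ)) : Prop where
  lt : ∀ e ∈ E, ∀ x ∈ e, x < n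
  card_four : ∀ e ∈ E, e.card = 4
  card_core : ∀ e ∈ E, (e.filter (· < 4)).card = 1
  linear : ∀ e ∈ E, ∀ f ∈ E, e ≠ f → (e ∩ f).card ≤ 1
  not_disjoint : ∀ e ∈ E, ∀ f ∈ E, ∀ g ∈ E, ∀ x ∈ e ∩ f, ∀ y ∈ g ∩ f,
    4 ≤ x → 4 ≤ y → ¬ Disjoint e g

/-- Quadruples with exactly one point in the core `{0, 1, 2, 3}`, any two of which share exactly
one point. -/
structure IsCoreBlock (B : Finset (Finset ℕ)) : Prop where
  card_four : ∀ e ∈ B, e.card = 4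
  card_core : ∀ e ∈ B, (e.filter (· < 4)).card = 1
  card_inter : ∀ e ∈ B, ∀ f ∈ B, e ≠ f → (e ∩ f).card = 1

theorem IsCoreBlock.mono {A B : Finset (Finset ℕ)} (hB : IsCoreBlock B) (h : A ⊆ B) :
    IsCoreBlock A where
  card_four e he := hB.card_four e (h he)
  card_core e he := hB.card_core e (h he)
  card_inter e he f hf := hB.card_inter e (h he) f (h hf)

/-- Translation by `k` of the natural numbers outside the core `{0, 1, 2, 3}`. -/
def coreShift (k : ℕ) : ℕ ↪ ℕ where
  toFun x := if x < 4 then x else x + k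
  inj' x y h := by
    dsimp only at h
    split_ifs at h <;> omega

theorem coreShift_apply (k x : ℕ) : coreShift k x = if x < 4 then x else x + k := rfl

theorem coreShift_lt_four {k x : ℕ} : coreShift k x < 4 ↔ x < 4 := by
  rw [coreShift_apply]
  split_ifs <;> omega

theorem IsCoreBlock.shift {B : Finset (Finset ℕ)} (hB : IsCoreBlock B) (k : ℕ) :
    IsCoreBlock (B.map (Finset.mapEmbedding (coreShift k)).toEmbedding) where
  card_four := by
    simpa [Finset.mapEmbedding_apply] using hB.card_four
  card_core := by
    simpa [Finset.mapEmbedding_apply, Finset.filter_map, Function.comp_def, coreShift_lt_four]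
      using hB.card_core
  card_inter := by
    simpa [Finset.mapEmbedding_apply, ← Finset.map_inter] using hB.card_inter

theorem isCoreSystem_empty (n : ℕ) : IsCoreSystem n ∅ := by
  constructor <;> simp

/-- A core system can be enlarged by a core block all of whose points outside the core are new. -/
theorem IsCoreSystem.union {m n : ℕ} {E B : Finset (Finset ℕ)} (hE : IsCoreSystem m E)
    (hB : IsCoreBlock B) (hmn : m ≤ n) (hlt : ∀ e ∈ B, ∀ x ∈ e, x < n)
    (hnew : ∀ e ∈ B, ∀ x ∈ e, 4 ≤ x → m ≤ x) : IsCoreSystem n (E ∪ B) := by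
  have cross : ∀ e ∈ E, ∀ f ∈ B, (e ∩ f).card ≤ 1 := by
    intro e he f hf
    rw [← hE.card_core e he]
    refine Finset.card_le_card fun x hx => ?_
    rw [Finset.mem_inter] at hx
    have h₁ := hE.lt e he x hx.1
    have h₂ := hnew f hf x hx.2
    exact Finset.mem_filter.2 ⟨hx.1, by omega⟩
  have same_side : ∀ e ∈ E ∪ B, ∀ f ∈ E ∪ B, ∀ x ∈ e ∩ f, 4 ≤ x → (e ∈ E ↔ f ∈ E) ∧
      (e ∈ B ↔ f ∈ B) := by
    have key : ∀ e ∈ E, ∀ f ∈ B, ∀ x ∈ e, x ∈ f → 4 ≤ x → False := fun e he f hf x hxe hxf hx => by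
      have h₁ := hE.lt e he x hxe
      have h₂ := hnew f hf x hxf hx
      omega
    intro e he f hf x hx h4
    rw [Finset.mem_inter] at hx
    rw [Finset.mem_union] at he hf
    have h₁ := fun h h' => key e h f h' x hx.1 hx.2 h4
    have h₂ := fun h h' => key f h e h' x hx.2 hx.1 h4
    tauto
  refine ⟨?_, ?_, ?_, ?_, ?_⟩
  · intro e he x hx
    rcases Finset.mem_union.1 he with he | he
    · exact (hE.lt e he x hx).trans_le hmn
    · exact hlt e he x hx
  · intro e he
    exact (Finset.mem_union.1 he).elim (hE.card_four e) (hB.card_four e)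
  · intro e he
    exact (Finset.mem_union.1 he).elim (hE.card_core e) (hB.card_core e)
  · intro e he f hf hef
    rcases Finset.mem_union.1 he with he | he <;> rcases Finset.mem_union.1 hf with hf | hf
    · exact hE.linear e he f hf hef
    · exact cross e he f hf
    · rw [Finset.inter_comm]
      exact cross f hf e he
    · exact (hB.card_inter e he f hf hef).le
  · intro e he f hf g hg x hx y hy hx4 hy4
    have hef := same_side e he f hf x hx hx4
    have hgf := same_side g hg f hf y hy hy4
    rcases Finset.mem_union.1 hf with hf | hf
    · exact hE.not_disjoint e (hef.1.2 hf) f hf g (hgf.1.2 hf) x hx y hy hx4 hy4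
    · have heB := hef.2.2 hf
      rw [Finset.disjoint_iff_inter_eq_empty, ← Finset.card_eq_zero]
      by_cases h : e = g
      · rw [← h, Finset.inter_self, hB.card_four e heB]
        decide
      · rw [hB.card_inter e heB g (hgf.2.2 hf) h]
        decide

theorem IsCoreSystem.exists_union {m r : ℕ} {E B : Finset (Finset ℕ)} (hE : IsCoreSystem m E)
    (hm : 4 ≤ m) (hB : IsCoreBlock B) (hlt : ∀ e ∈ B, ∀ x ∈ e, x < 4 + r) :
    ∃ F, IsCoreSystem (m + r) F ∧ F.card = E.card + B.card := by
  set C := B.map (Finset.mapEmbedding (coreShift (m - 4))).toEmbedding with hC_def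
  have hC : IsCoreBlock C := hB.shift (m - 4)
  have hClt : ∀ e ∈ C, ∀ x ∈ e, x < m + r ∧ (4 ≤ x → m ≤ x) := by
    simp only [hC_def, Finset.mem_map, RelEmbedding.coe_toEmbedding, Finset.mapEmbedding_apply]
    rintro _ ⟨e, he, rfl⟩ x hx
    obtain ⟨y, hy, rfl⟩ := Finset.mem_map.1 hx
    have := hlt e he y hy
    rw [coreShift_apply]
    split_ifs <;> omega
  refine ⟨E ∪ C, hE.union hC (by omega) (fun e he x hx => (hClt e he x hx).1)
    (fun e he x hx => (hClt e he x hx).2), ?_⟩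
  rw [Finset.card_union_of_disjoint, hC_def, Finset.card_map]
  refine Finset.disjoint_left.2 fun e he heC => ?_
  have hsub : e ⊆ e.filter (· < 4) := fun x hx => by
    have h₁ := hE.lt e he x hx
    have h₂ := (hClt e heC x hx).2
    exact Finset.mem_filter.2 ⟨hx, by omega⟩
  have := Finset.card_le_card hsub
  rw [hE.card_four e he, hE.card_core e he] at this
  omega

/-- The twelve lines of the affine plane of order three on `{4, …, 12}`, each extended by its
point at infinity in `{0, 1, 2, 3}`. -/
def affineBlock : Finset (Finset ℕ) :=
  {{0, 4, 7, 10}, {0, 5, 8, 11}, {0, 6, 9, 12},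
   {1, 4, 8, 12}, {1, 5, 9, 10}, {1, 6, 7, 11},
   {2, 4, 9, 11}, {2, 5, 7, 12}, {2, 6, 8, 10},
   {3, 4, 5, 6}, {3, 7, 8, 9}, {3, 10, 11, 12}}

/-- The stars of the four vertices of a complete graph with edge set `{4, …, 9}`, each extended by
its own core point. -/
def starBlock : Finset (Finset ℕ) :=
  {{0, 4, 5, 6}, {1, 4, 7, 8}, {2, 5, 7, 9}, {3, 6, 8, 9}}

theorem isCoreBlock_affineBlock : IsCoreBlock affineBlock := by
  constructor <;> decide +kernel

theorem isCoreBlock_starBlock : IsCoreBlock starBlock := by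
  constructor <;> decide +kernel

theorem exists_isCoreBlock_of_eps (n : ℕ) : ∃ B, IsCoreBlock B ∧
    (∀ e ∈ B, ∀ x ∈ e, x < 4 + (n - 4) % 9) ∧ eps n ≤ B.card := by
  have key : ∀ A, IsCoreBlock A → ∀ r, IsCoreBlock (A.filter fun e => ∀ x ∈ e, x < 4 + r) ∧
      ∀ e ∈ A.filter (fun e => ∀ x ∈ e, x < 4 + r), ∀ x ∈ e, x < 4 + r :=
    fun A hA r => ⟨hA.mono (Finset.filter_subset _ _), fun e he => (Finset.mem_filter.1 he).2⟩
  have hr : (n - 4) % 9 < 9 := Nat.mod_lt _ (by decide)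
  rw [eps]
  generalize (n - 4) % 9 = r at hr
  by_cases h : r ≤ 6
  · refine ⟨_, (key _ isCoreBlock_starBlock r).1, (key _ isCoreBlock_starBlock r).2, ?_⟩
    interval_cases r <;> decide +kernel
  · refine ⟨_, (key _ isCoreBlock_affineBlock r).1, (key _ isCoreBlock_affineBlock r).2, ?_⟩
    interval_cases r <;> first | omega | decide +kernel

theorem exists_isCoreSystem_nine_mul (q : ℕ) :
    ∃ E, IsCoreSystem (4 + 9 * q) E ∧ E.card = 12 * q := by
  induction q with
  | zero => exact ⟨∅, isCoreSystem_empty _, rfl⟩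
  | succ q ih =>
    obtain ⟨E, hE, hcard⟩ := ih
    obtain ⟨F, hF, hFcard⟩ := hE.exists_union (r := 9) (by omega) isCoreBlock_affineBlock
      (by decide +kernel)
    refine ⟨F, hF, ?_⟩
    rw [hFcard, hcard, show affineBlock.card = 12 by decide +kernel]
    ring

/-- In a core system no quadruple meets three pairwise disjoint quadruples. -/
theorem IsCoreSystem.false_of_disjoint {n : ℕ} {E : Finset (Finset ℕ)} (hE : IsCoreSystem n E)
    {a b c f : Finset ℕ} (ha : a ∈ E) (hb : b ∈ E) (hc : c ∈ E) (hf : f ∈ E)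
    (hab : Disjoint a b) (hac : Disjoint a c) (hbc : Disjoint b c)
    (hfa : (f ∩ a).Nonempty) (hfb : (f ∩ b).Nonempty) (hfc : (f ∩ c).Nonempty) : False := by
  obtain ⟨x, hx⟩ := hfa
  obtain ⟨y, hy⟩ := hfb
  obtain ⟨z, hz⟩ := hfc
  rw [Finset.inter_comm] at hx hy hz
  have core : ∀ s t, Disjoint s t → ∀ u ∈ s ∩ f, ∀ v ∈ t ∩ f, u < 4 → ¬ v < 4 := by
    intro s t hst u hu v hv hu4 hv4
    rw [Finset.mem_inter] at hu hv
    have huv := Finset.card_le_one.1 (hE.card_core f hf).le u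
      (Finset.mem_filter.2 ⟨hu.2, hu4⟩) v (Finset.mem_filter.2 ⟨hv.2, hv4⟩)
    exact Finset.disjoint_left.1 hst hu.1 (huv ▸ hv.1)
  have h₁ := core a b hab x hx y hy
  have h₂ := core a c hac x hx z hz
  have h₆ := core b c hbc y hy z hz
  have h₃ : ¬ (4 ≤ x ∧ 4 ≤ y) := fun ⟨p, q⟩ => hE.not_disjoint a ha f hf b hb x hx y hy p q hab
  have h₄ : ¬ (4 ≤ x ∧ 4 ≤ z) := fun ⟨p, q⟩ => hE.not_disjoint a ha f hf c hc x hx z hz p q hac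
  have h₅ : ¬ (4 ≤ y ∧ 4 ≤ z) := fun ⟨p, q⟩ => hE.not_disjoint b hb f hf c hc y hy z hz p q hbc
  omega

theorem IsCoreSystem.exists_linearQuadSystem {n : ℕ} {E : Finset (Finset ℕ)}
    (hE : IsCoreSystem n E) :
    ∃ H : LinearQuadSystem n, ¬ ContainsE4plus H ∧ H.edges.card = E.card := by
  let φ := (Finset.mapEmbedding (Fin.valEmbedding (n := n))).toEmbedding
  have hφ : ∀ s, φ s = s.map Fin.valEmbedding := fun _ => rfl
  have hmem : ∀ s, s ∈ Finset.univ.filter (fun s => φ s ∈ E) ↔ φ s ∈ E := by simp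
  have hcard : ∀ s, (φ s).card = s.card := fun s => Finset.card_map _
  have hinter : ∀ s t, φ (s ∩ t) = φ s ∩ φ t := fun s t => Finset.map_inter _ _
  refine ⟨⟨Finset.univ.filter fun s => φ s ∈ E, ?_, ?_⟩, ?_, ?_⟩
  · intro e he
    rw [← hcard]
    exact hE.card_four _ ((hmem e).1 he)
  · intro e he f hf hef
    rw [← hcard, hinter]
    exact hE.linear _ ((hmem e).1 he) _ ((hmem f).1 hf) (φ.injective.ne hef)
  · rintro ⟨a, b, c, f, ha, hb, hc, hf, hab, hac, hbc, hfa, hfb, hfc⟩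
    have hne : ∀ s, (f ∩ s).card = 1 → (φ f ∩ φ s).Nonempty := fun s hs => by
      rw [← hinter, ← Finset.card_pos, hcard, hs]
      exact one_pos
    have hdisj : ∀ s t : Finset (Fin n), Disjoint s t → Disjoint (φ s) (φ t) :=
      fun s t h => (Finset.disjoint_map _).2 h
    exact hE.false_of_disjoint ((hmem a).1 ha) ((hmem b).1 hb) ((hmem c).1 hc) ((hmem f).1 hf)
      (hdisj _ _ hab) (hdisj _ _ hac) (hdisj _ _ hbc) (hne _ hfa) (hne _ hfb) (hne _ hfc)
  · change (Finset.univ.filter fun s => φ s ∈ E).card = E.card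
    rw [← Finset.card_map φ]
    congr 1
    ext e
    simp only [Finset.mem_map, hmem]
    refine ⟨?_, fun he => ?_⟩
    · rintro ⟨s, hs, rfl⟩
      exact hs
    · have : φ (e.attachFin (hE.lt e he)) = e := by
        rw [hφ]
        exact Finset.map_valEmbedding_attachFin _
      exact ⟨_, this.symm ▸ he, this⟩

/-- for `n ≥ 4` there is an `E_4^+`-free linear quadruple system on `n`
vertices with at least `12⌊(n-4)/9⌋ + ε` quadruples. -/
theorem linear_turan_E4plus_lower (n : ℕ) (hn : 4 ≤ n) :
    ∃ H : LinearQuadSystem n, ¬ ContainsE4plus H ∧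
      12 * ((n - 4) / 9) + eps n ≤ H.edges.card := by
  obtain ⟨E, hE, hEcard⟩ := exists_isCoreSystem_nine_mul ((n - 4) / 9)
  obtain ⟨B, hB, hlt, hBcard⟩ := exists_isCoreBlock_of_eps n
  obtain ⟨F, hF, hFcard⟩ := hE.exists_union (by omega) hB hlt
  rw [show 4 + 9 * ((n - 4) / 9) + (n - 4) % 9 = n by omega] at hF
  obtain ⟨H, hH, hHcard⟩ := hF.exists_linearQuadSystem
  exact ⟨H, hH, by omega⟩
end

section
/- Every E_4^+-free linear quadruple system on n vertices has at most 2n quadruples; that is, ex^lin_4(n, E_4^+) ≤ 2n. -/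
namespace LinearQuadSystem

variable {n : ℕ} (H : LinearQuadSystem n)

/-- The number of quadruples through a vertex. -/
def degree (x : Fin n) : ℕ := (H.edges.filter (x ∈ ·)).card

variable {H}

theorem eq_of_mem_of_mem {e f : Finset (Fin n)} (he : e ∈ H.edges) (hf : f ∈ H.edges)
    {x y : Fin n} (hxy : x ≠ y) (hxe : x ∈ e) (hye : y ∈ e) (hxf : x ∈ f) (hyf : y ∈ f) :
    e = f := by
  by_contra hef
  have h := H.linear e he f hf hef
  rw [Finset.card_le_one] at h
  exact hxy (h x (by simp [hxe, hxf]) y (by simp [hye, hyf]))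

theorem card_inter_eq_one {e f : Finset (Fin n)} (he : e ∈ H.edges) (hf : f ∈ H.edges)
    (hef : e ≠ f) {x : Fin n} (hxe : x ∈ e) (hxf : x ∈ f) : (f ∩ e).card = 1 := by
  apply le_antisymm (H.linear f hf e he hef.symm)
  exact Finset.card_pos.mpr ⟨x, by simp [hxe, hxf]⟩

theorem exists_edge_disjoint (f : Finset (Fin n)) {x : Fin n} {S : Finset (Fin n)}
    (hxS : x ∉ S) (hdeg : S.card + 2 ≤ H.degree x) :
    ∃ e ∈ H.edges, x ∈ e ∧ e ≠ f ∧ Disjoint e S := by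
  by_contra! hne
  have hmeet : ∀ e ∈ (H.edges.filter (x ∈ ·)).erase f, ∃ s ∈ S, s ∈ e := by
    intro e he
    simp only [Finset.mem_erase, Finset.mem_filter] at he
    obtain ⟨s, hse, hsS⟩ := Finset.not_disjoint_iff.mp (hne e he.2.1 he.2.2 he.1)
    exact ⟨s, hsS, hse⟩
  have : Nonempty (Fin n) := ⟨x⟩
  choose! g hgS hge using hmeet
  have hcard : S.card < ((H.edges.filter (x ∈ ·)).erase f).card := by
    have := Finset.pred_card_le_card_erase (s := H.edges.filter (x ∈ ·)) (a := f)
    unfold degree at hdeg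
    omega
  obtain ⟨e, he, e', he', hee', hg⟩ :=
    Finset.exists_ne_map_eq_of_card_lt_of_maps_to hcard (f := g) hgS
  have hme := hge e he
  have hme' := hge e' he'
  have hxg : x ≠ g e := fun h => hxS (h ▸ hgS e he)
  simp only [Finset.mem_erase, Finset.mem_filter] at he he'
  exact hee' (eq_of_mem_of_mem he.2.1 he'.2.1 hxg he.2.2 hme he'.2.2 (hg ▸ hme'))

theorem containsE4plus_of_degree {f : Finset (Fin n)} (hf : f ∈ H.edges) {a b c : Fin n}
    (ha : a ∈ f) (hb : b ∈ f) (hc : c ∈ f) (hba : b ≠ a) (hca : c ≠ a) (hcb : c ≠ b)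
    (hda : 8 ≤ H.degree a) (hdb : 5 ≤ H.degree b) (hdc : 2 ≤ H.degree c) :
    ContainsE4plus H := by
  have hnot : ∀ {e x y}, e ∈ H.edges → e ≠ f → x ∈ e → x ∈ f → y ∈ f → x ≠ y → y ∉ e :=
    fun he hef hxe hxf hyf hxy hye => hef (eq_of_mem_of_mem he hf hxy hxe hye hxf hyf)
  obtain ⟨u, hu, hcu, huf, -⟩ :=
    exists_edge_disjoint (H := H) f (x := c) (S := ∅) (by simp) (by simpa using hdc)
  have hu4 := H.card_four u hu
  obtain ⟨v, hv, hbv, hvf, hvu⟩ := exists_edge_disjoint (H := H) f (x := b) (S := u.erase c)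
    (fun h => hnot hu huf hcu hc hb hcb (Finset.mem_of_mem_erase h))
    (by rw [Finset.card_erase_of_mem hcu]; omega)
  have hv4 := H.card_four v hv
  obtain ⟨w, hw, haw, hwf, hwuv⟩ := exists_edge_disjoint (H := H) f (x := a)
    (S := u.erase c ∪ v.erase b)
    (by
      rw [Finset.mem_union]
      rintro (h | h)
      · exact hnot hu huf hcu hc ha hca (Finset.mem_of_mem_erase h)
      · exact hnot hv hvf hbv hb ha hba (Finset.mem_of_mem_erase h))
    (by
      have := Finset.card_union_le (u.erase c) (v.erase b)
      rw [Finset.card_erase_of_mem hcu, Finset.card_erase_of_mem hbv] at this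
      omega)
  have hcv : c ∉ v := hnot hv hvf hbv hb hc hcb.symm
  have hcw : c ∉ w := hnot hw hwf haw ha hc hca.symm
  have hbw : b ∉ w := hnot hw hwf haw ha hb hba.symm
  rw [Finset.disjoint_union_right] at hwuv
  have extend : ∀ {s t : Finset (Fin n)} {x}, x ∉ s → Disjoint s (t.erase x) → Disjoint s t := by
    intro s t x hx h
    rwa [← Finset.disjoint_erase_comm, Finset.erase_eq_of_notMem hx] at h
  exact ⟨w, v, u, f, hw, hv, hu, hf, extend hbw hwuv.2, extend hcw hwuv.1, extend hcv hvu,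
    card_inter_eq_one hw hf hwf haw ha, card_inter_eq_one hv hf hvf hbv hb,
    card_inter_eq_one hu hf huf hcu hc⟩

theorem degree_pos {f : Finset (Fin n)} (hf : f ∈ H.edges) {x : Fin n} (hx : x ∈ f) :
    0 < H.degree x :=
  Finset.card_pos.mpr ⟨f, by simp [hf, hx]⟩

theorem exists_degree_gt {f s : Finset (Fin n)} (hf : f ∈ H.edges) (hs : s ⊆ f) (k : ℕ)
    (hlt : ∑ x ∈ f, (1 : ℚ) / H.degree x < s.card * (1 / k)) : ∃ x ∈ s, k < H.degree x := by
  by_contra! hle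
  refine hlt.not_ge ?_
  calc (s.card : ℚ) * (1 / k) = ∑ x ∈ s, (1 : ℚ) / k := by simp
    _ ≤ ∑ x ∈ s, (1 : ℚ) / H.degree x := Finset.sum_le_sum fun x hx =>
        one_div_le_one_div_of_le (by exact_mod_cast degree_pos hf (hs hx))
          (by exact_mod_cast hle x hx)
    _ ≤ _ := Finset.sum_le_sum_of_subset_of_nonneg hs fun _ _ _ => by positivity

theorem half_le_sum_inv_degree (hfree : ¬ ContainsE4plus H) {f : Finset (Fin n)}
    (hf : f ∈ H.edges) : 1 / 2 ≤ ∑ x ∈ f, (1 : ℚ) / H.degree x := by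
  by_contra! hlt
  have hf4 := H.card_four f hf
  obtain ⟨a, ha, hda⟩ := exists_degree_gt hf subset_rfl 7 (hlt.trans (by norm_num [hf4]))
  have h3 : (f.erase a).card = 3 := by rw [Finset.card_erase_of_mem ha, hf4]
  obtain ⟨b, hb, hdb⟩ := exists_degree_gt hf (Finset.erase_subset a f) 4
    (hlt.trans (by norm_num [h3]))
  have h2 : ((f.erase a).erase b).card = 2 := by rw [Finset.card_erase_of_mem hb, h3]
  obtain ⟨c, hc, hdc⟩ := exists_degree_gt hf
    ((Finset.erase_subset b _).trans (Finset.erase_subset a f)) 1 (hlt.trans (by norm_num [h2]))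
  simp only [Finset.mem_erase] at hb hc
  exact hfree (containsE4plus_of_degree hf ha hb.2 hc.2.2 hb.1 hc.2.1 hc.1 hda hdb hdc)

variable (H) in
theorem sum_sum_inv_degree_le : ∑ f ∈ H.edges, ∑ x ∈ f, (1 : ℚ) / H.degree x ≤ n := by
  rw [Finset.sum_comm' (t' := Finset.univ) (s' := fun x => H.edges.filter (x ∈ ·))
    (by simp)]
  calc ∑ x, ∑ _f ∈ H.edges.filter (x ∈ ·), (1 : ℚ) / H.degree x
      ≤ ∑ _x : Fin n, (1 : ℚ) := Finset.sum_le_sum fun x _ => by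
        rw [Finset.sum_const, nsmul_eq_mul, mul_one_div]
        exact div_self_le_one _
    _ = n := by simp

end LinearQuadSystem

/-- every `E_4^+`-free linear quadruple system on `n` vertices has at
most `2n` quadruples. -/
theorem linear_turan_E4plus_upper (n : ℕ) (H : LinearQuadSystem n)
    (hfree : ¬ ContainsE4plus H) : H.edges.card ≤ 2 * n := by
  have hlow := Finset.card_nsmul_le_sum H.edges _ _
    fun f hf => LinearQuadSystem.half_le_sum_inv_degree hfree hf
  have hup := H.sum_sum_inv_degree_le
  rw [nsmul_eq_mul] at hlow
  have : (H.edges.card : ℚ) ≤ 2 * n := by linarith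
  exact_mod_cast this
end

section
/- Let n, k ≥ 1 be positive integers. Then every P_k-free linear quadruple system on n vertices has at most 2.5·k·n quadruples; that is, ex^lin_4(n, P_k) ≤ 5kn/2. -/
namespace LinearPath

open Finset

variable {α : Type*} [DecidableEq α]

/-- The edges `e 0, …, e (j-1)` form a linear path in `E`. -/
structure IsPath (E : Finset (Finset α)) (j : ℕ) (e : ℕ → Finset α) : Prop where
  mem : ∀ i, i < j → e i ∈ E
  card_inter : ∀ i, i + 1 < j → (e i ∩ e (i + 1)).card = 1
  disj : ∀ i i', i + 2 ≤ i' → i' < j → Disjoint (e i) (e i')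

/-- The edges `c 0, …, c (m-1)` form a linear cycle in `E`. -/
structure IsCycle (E : Finset (Finset α)) (m : ℕ) (c : ℕ → Finset α) : Prop where
  mem : ∀ i, i < m → c i ∈ E
  card_inter : ∀ i, i + 1 < m → (c i ∩ c (i + 1)).card = 1
  card_inter_last : (c (m - 1) ∩ c 0).card = 1
  disj : ∀ i i', i + 2 ≤ i' → i' < m → ¬ (i = 0 ∧ i' = m - 1) → Disjoint (c i) (c i')

/-- The vertices covered by `e 0, …, e (j-1)`. -/
def verts (j : ℕ) (e : ℕ → Finset α) : Finset α := (range j).biUnion e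

lemma mem_verts {j : ℕ} {e : ℕ → Finset α} {v : α} : v ∈ verts j e ↔ ∃ i < j, v ∈ e i := by
  simp [verts]

variable {E : Finset (Finset α)} {j k m : ℕ} {e c : ℕ → Finset α}

lemma eq_of_two_mem (hlin : ∀ e ∈ E, ∀ f ∈ E, e ≠ f → (e ∩ f).card ≤ 1)
    {f g : Finset α} (hf : f ∈ E) (hg : g ∈ E) {x y : α} (hxy : x ≠ y)
    (hxf : x ∈ f) (hxg : x ∈ g) (hyf : y ∈ f) (hyg : y ∈ g) : f = g := by
  by_contra hne
  exact hxy (card_le_one.1 (hlin f hf g hg hne) x (by simp [hxf, hxg]) y (by simp [hyf, hyg]))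

lemma IsPath.snoc (he : IsPath E j e) {f : Finset α} (hf : f ∈ E)
    (h1 : 0 < j → (e (j - 1) ∩ f).card = 1) (h2 : ∀ i, i + 1 < j → Disjoint (e i) f) :
    IsPath E (j + 1) (fun i => if i < j then e i else f) := by
  refine ⟨fun i hi => ?_, fun i hi => ?_, fun i i' hi hi' => ?_⟩
  · by_cases h : i < j
    · simpa [h] using he.mem i h
    · simpa [h] using hf
  · by_cases h : i + 1 < j
    · simpa [h, show i < j by omega] using he.card_inter i h
    · obtain rfl : j = i + 1 := by omega
      simpa using h1 (by omega)
  · by_cases h : i' < j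
    · simpa [h, show i < j by omega] using he.disj i i' hi h
    · simpa [h, show i < j by omega] using h2 i (by omega)

lemma IsPath.reverse (he : IsPath E j e) : IsPath E j (fun i => e (j - 1 - i)) := by
  refine ⟨fun i hi => he.mem _ (by omega), fun i hi => ?_, fun i i' hi hi' => ?_⟩
  · rw [inter_comm, show j - 1 - i = j - 1 - (i + 1) + 1 by omega]
    exact he.card_inter _ (by omega)
  · exact (he.disj _ _ (by omega) (by omega)).symm

lemma verts_reverse : verts j (fun i => e (j - 1 - i)) = verts j e := by
  ext v
  simp only [mem_verts]
  constructor
  · rintro ⟨i, hi, hv⟩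
    exact ⟨j - 1 - i, by omega, hv⟩
  · rintro ⟨i, hi, hv⟩
    exact ⟨j - 1 - i, by omega, by rwa [show j - 1 - (j - 1 - i) = i by omega]⟩

lemma card_verts_diff_last (h4 : ∀ e ∈ E, e.card = 4) (he : IsPath E j e) :
    (verts j e \ e (j - 1)).card ≤ 3 * (j - 1) := by
  have hsub : verts j e \ e (j - 1) ⊆ (range (j - 1)).biUnion (fun i => e i \ e (i + 1)) := by
    intro v hv
    rw [mem_sdiff, mem_verts] at hv
    obtain ⟨⟨i, hi, hvi⟩, hvl⟩ := hv
    have hex : ∃ t, v ∈ e (j - 1 - t) ∧ t ≤ j - 1 := ⟨j - 1 - i, by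
      rw [show j - 1 - (j - 1 - i) = i by omega]; exact ⟨hvi, by omega⟩⟩
    classical
    obtain ⟨ht, htj⟩ := Nat.find_spec hex
    have hmin := fun t => @Nat.find_min _ _ hex t
    set t := Nat.find hex
    have ht0 : t ≠ 0 := by
      intro h0
      rw [h0] at ht
      exact hvl ht
    rw [mem_biUnion]
    refine ⟨j - 1 - t, by rw [mem_range]; omega, ?_⟩
    rw [mem_sdiff]
    refine ⟨ht, fun hv' => hmin (t - 1) (by omega) ⟨?_, by omega⟩⟩
    rwa [show j - 1 - (t - 1) = j - 1 - t + 1 by omega]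
  refine (card_le_card hsub).trans ?_
  have := card_biUnion_le_card_mul (range (j - 1)) (fun i => e i \ e (i + 1)) 3 (by
    intro i hi
    rw [mem_range] at hi
    have h1 := card_sdiff_add_card_inter (e i) (e (i + 1))
    rw [he.card_inter i (by omega), h4 _ (he.mem i (by omega))] at h1
    omega)
  rw [card_range] at this
  omega

lemma IsCycle.rotate_one (hc : IsCycle E m c) (hm : 3 ≤ m) :
    IsCycle E m (fun i => if i + 1 < m then c (i + 1) else c 0) := by
  refine ⟨fun i hi => ?_, fun i hi => ?_, ?_, fun i i' hi hi' hne => ?_⟩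
  · split_ifs with h
    · exact hc.mem _ h
    · exact hc.mem _ (by omega)
  · by_cases h : i + 1 + 1 < m
    · simpa [h, hi] using hc.card_inter (i + 1) h
    · have h' := hc.card_inter_last
      rw [show m - 1 = i + 1 by omega] at h'
      simpa [h, hi] using h'
  · simpa [show ¬ (m - 1 + 1 < m) by omega, show 1 < m by omega] using
      hc.card_inter 0 (by omega)
  · by_cases h : i' + 1 < m
    · simpa [h, show i + 1 < m by omega] using hc.disj (i + 1) (i' + 1) (by omega) h (by omega)
    · simpa [h, show i + 1 < m by omega] using
        (hc.disj 0 (i + 1) (by omega) (by omega) (by omega)).symm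

lemma verts_rotate_one (hm : 1 ≤ m) :
    verts m (fun i => if i + 1 < m then c (i + 1) else c 0) = verts m c := by
  ext v
  simp only [mem_verts]
  constructor
  · rintro ⟨i, hi, hv⟩
    split_ifs at hv with h
    · exact ⟨i + 1, h, hv⟩
    · exact ⟨0, by omega, hv⟩
  · rintro ⟨i, hi, hv⟩
    rcases Nat.eq_zero_or_pos i with rfl | h0
    · exact ⟨m - 1, by omega, by simpa [show ¬ (m - 1 + 1 < m) by omega] using hv⟩
    · refine ⟨i - 1, by omega, ?_⟩
      rw [show i - 1 + 1 = i by omega]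
      simpa [hi] using hv

lemma IsCycle.exists_rotate (hm : 3 ≤ m) (s : ℕ) : ∀ {c : ℕ → Finset α}, IsCycle E m c → s < m →
    ∃ c', IsCycle E m c' ∧ verts m c' = verts m c ∧ c' 0 = c s := by
  induction s with
  | zero => exact fun {c} hc _ => ⟨c, hc, rfl, rfl⟩
  | succ s ih =>
    intro c hc hs
    obtain ⟨c', h1, h2, h3⟩ := ih (hc.rotate_one hm) (by omega)
    exact ⟨c', h1, h2.trans (verts_rotate_one (by omega)), by simpa [hs] using h3⟩

/-- An edge meeting a linear cycle in a single vertex opens it to a path with as many edges. -/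
lemma IsCycle.exists_path (hc : IsCycle E m c) (hm : 4 ≤ m) {h : Finset α} (hh : h ∈ E)
    {v : α} (hv : h ∩ verts m c = {v}) : ∃ p, IsPath E m p := by
  have hvC : v ∈ verts m c := (mem_inter.1 (hv ▸ mem_singleton_self v)).2
  obtain ⟨c₁, hc₁, hV₁, hv0, hv1⟩ :
      ∃ c', IsCycle E m c' ∧ verts m c' = verts m c ∧ v ∈ c' 0 ∧ v ∉ c' 1 := by
    obtain ⟨s, hs, hvs⟩ := mem_verts.1 hvC
    obtain ⟨c', h1, h2, h3⟩ := hc.exists_rotate (by omega) s hs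
    by_cases hv1 : v ∈ c' 1
    · obtain ⟨c'', h1', h2', h3'⟩ := h1.exists_rotate (by omega) 1 (by omega)
      refine ⟨_, h1.rotate_one (by omega), (verts_rotate_one (by omega)).trans h2, ?_, ?_⟩
      · simpa [show 1 < m by omega] using hv1
      · have := disjoint_left.1 (h1.disj 0 2 (by omega) (by omega) (by omega)) (h3 ▸ hvs)
        simpa [show 1 + 1 < m by omega] using this
    · exact ⟨c', h1, h2, h3 ▸ hvs, hv1⟩
  rw [← hV₁] at hv
  have hp : IsPath E (m - 1) (fun i => c₁ (m - 1 - 1 - i)) :=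
    IsPath.reverse ⟨fun i hi => hc₁.mem i (by omega), fun i hi => hc₁.card_inter i (by omega),
      fun i i' hi hi' => hc₁.disj i i' hi (by omega) (by omega)⟩
  have hmeet : ∀ i < m, ∀ x ∈ c₁ i, x ∈ h → x = v := fun i hi x hx hxh =>
    mem_singleton.1 (hv ▸ mem_inter.2 ⟨hxh, mem_verts.2 ⟨i, hi, hx⟩⟩)
  have := hp.snoc hh (fun _ => ?_) (fun i hi => ?_)
  · rw [show m - 1 + 1 = m by omega] at this
    exact ⟨_, this⟩
  · rw [show m - 1 - 1 - (m - 1 - 1) = 0 by omega, card_eq_one]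
    refine ⟨v, ?_⟩
    ext x
    rw [mem_inter, mem_singleton]
    constructor
    · rintro ⟨hx, hxh⟩
      exact hmeet 0 (by omega) x hx hxh
    · rintro rfl
      exact ⟨hv0, (mem_inter.1 (hv ▸ mem_singleton_self x)).1⟩
  · rw [disjoint_left]
    intro x hx hxh
    obtain rfl := hmeet _ (by omega) x hx hxh
    by_cases h1 : m - 1 - 1 - i = 1
    · rw [h1] at hx
      exact hv1 hx
    · exact disjoint_left.1 (hc₁.disj 0 _ (by omega) (by omega) (by omega)) hv0 hx

/-- The vertices `w` of the path for which some edge meets the path exactly in `z` and `w`. -/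
def ends (E : Finset (Finset α)) (V : Finset α) (z : α) : Finset α :=
  V.filter fun w => w ≠ z ∧ ∃ f ∈ E, f ∩ V = {z, w}

/-- In a maximal path, the last vertex is the end of many edges meeting the path exactly twice. -/
lemma degree_le_card_ends (h4 : ∀ e ∈ E, e.card = 4)
    (hlin : ∀ e ∈ E, ∀ f ∈ E, e ≠ f → (e ∩ f).card ≤ 1) (hj : 0 < j) (he : IsPath E j e)
    (hmax : ∀ p, ¬ IsPath E (j + 1) p) {z : α} (hz : z ∈ e (j - 1))
    (hz' : ∀ i, i + 1 < j → z ∉ e i) :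
    2 * (E.filter (z ∈ ·)).card ≤ (ends E (verts j e) z).card + 3 * (j - 1) + 2 := by
  have hlast : e (j - 1) ∈ E := he.mem _ (by omega)
  set V := verts j e
  set W := V \ e (j - 1) with hW
  set D := (E.filter (z ∈ ·)).erase (e (j - 1)) with hD
  have hDcard : (E.filter (z ∈ ·)).card = D.card + 1 := by
    rw [hD, card_erase_add_one]
    simp [hlast, hz]
  have hDmem : ∀ f ∈ D, f ∈ E ∧ z ∈ f ∧ f ≠ e (j - 1) := by
    intro f hf
    simp only [hD, mem_erase, mem_filter] at hf
    tauto
  have hzW : z ∉ W := by simp [hW, hz]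
  have hflast : ∀ f ∈ D, ∀ x ∈ f, x ∈ e (j - 1) → x = z := by
    intro f hf x hx hx'
    obtain ⟨h1, h2, h3⟩ := hDmem f hf
    by_contra hne
    exact h3 (eq_of_two_mem hlin h1 hlast hne hx hx' h2 hz)
  have hpos : ∀ f ∈ D, 1 ≤ (f ∩ W).card := by
    intro f hf
    obtain ⟨h1, h2, h3⟩ := hDmem f hf
    rw [Nat.one_le_iff_ne_zero, Ne, card_eq_zero]
    intro h0
    refine hmax _ (he.snoc h1 (fun _ => ?_) (fun i hi => ?_))
    · rw [card_eq_one]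
      refine ⟨z, ?_⟩
      ext x
      rw [mem_inter, mem_singleton]
      exact ⟨fun hx => hflast f hf x hx.2 hx.1, fun hx => hx ▸ ⟨hz, h2⟩⟩
    · rw [disjoint_left]
      intro x hx hxf
      have hxV : x ∈ V := mem_verts.2 ⟨i, by omega, hx⟩
      by_cases hxl : x ∈ e (j - 1)
      · obtain rfl := hflast f hf x hxf hxl
        exact hz' i hi hx
      · have : x ∈ f ∩ W := by simp [hW, hxf, hxV, hxl]
        simp [h0] at this
  have hdisj : ∀ f ∈ D, ∀ g ∈ D, f ≠ g → Disjoint (f ∩ W) (g ∩ W) := by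
    intro f hf g hg hne
    rw [disjoint_left]
    intro x hx hx'
    rw [mem_inter] at hx hx'
    refine hne (eq_of_two_mem hlin (hDmem f hf).1 (hDmem g hg).1 (x := x) (y := z) ?_ hx.1 hx'.1
      (hDmem f hf).2.1 (hDmem g hg).2.1)
    rintro rfl
    exact hzW hx.2
  have hsum : ∑ f ∈ D, (f ∩ W).card ≤ W.card := by
    rw [← card_biUnion hdisj]
    refine card_le_card fun x hx => ?_
    simp only [mem_biUnion, mem_inter] at hx
    obtain ⟨_, _, _, h⟩ := hx
    exact h
  have hsingle : (D.filter fun f => (f ∩ W).card = 1).card ≤ (ends E V z).card := by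
    have hsub : (D.filter fun f => (f ∩ W).card = 1).biUnion (· ∩ W) ⊆ ends E V z := by
      intro w hw
      simp only [mem_biUnion, mem_filter] at hw
      obtain ⟨f, ⟨hf, hf1⟩, hw⟩ := hw
      obtain ⟨h1, h2, h3⟩ := hDmem f hf
      have hwW := (mem_inter.1 hw).2
      rw [ends, mem_filter]
      refine ⟨(mem_sdiff.1 hwW).1, fun h => hzW (h ▸ hwW), f, h1, ?_⟩
      ext x
      rw [mem_inter, mem_insert, mem_singleton]
      constructor
      · rintro ⟨hx, hxV⟩
        by_cases hxl : x ∈ e (j - 1)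
        · exact Or.inl (hflast f hf x hx hxl)
        · exact Or.inr (card_le_one.1 hf1.le x (by simp [hW, hx, hxV, hxl]) w hw)
      · rintro (rfl | rfl)
        · exact ⟨h2, mem_verts.2 ⟨j - 1, by omega, hz⟩⟩
        · exact ⟨(mem_inter.1 hw).1, (mem_sdiff.1 hwW).1⟩
    refine le_trans (le_of_eq ?_) (card_le_card hsub)
    rw [card_biUnion fun f hf g hg =>
      hdisj f (mem_filter.1 hf).1 g (mem_filter.1 hg).1, sum_congr rfl fun f hf =>
      (mem_filter.1 hf).2]
    simp
  have hlow : 2 * D.card ≤ ∑ f ∈ D, (f ∩ W).card + (D.filter fun f => (f ∩ W).card = 1).card := by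
    rw [card_filter, ← sum_add_distrib, mul_comm, ← smul_eq_mul, ← sum_const]
    refine sum_le_sum fun f hf => ?_
    have := hpos f hf
    split_ifs <;> omega
  have : W.card ≤ 3 * (j - 1) := card_verts_diff_last h4 he
  omega

/-- The elements of `ends` other than `a` whose first occurrence on the path is in `e l`. -/
def block (E : Finset (Finset α)) (V : Finset α) (e : ℕ → Finset α) (z a : α) (l : ℕ) :
    Finset α :=
  (ends E V z).filter fun w => w ≠ a ∧ w ∈ e l ∧ ∀ i < l, w ∉ e i

lemma card_block_le (h4 : ∀ e ∈ E, e.card = 4) (he : IsPath E j e) {V : Finset α} {z a : α}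
    (ha : a ∈ e 0) {l : ℕ} (hl : l < j) : (block E V e z a l).card ≤ 3 := by
  obtain ⟨x, hx, hxb⟩ : ∃ x ∈ e l, x ∉ block E V e z a l := by
    rcases l with _ | l
    · exact ⟨a, ha, by simp [block]⟩
    · obtain ⟨x, hx⟩ := card_pos.1 (by rw [he.card_inter l hl]; exact one_pos)
      rw [mem_inter] at hx
      refine ⟨x, hx.2, fun hb => ?_⟩
      exact (mem_filter.1 hb).2.2.2 l (by omega) hx.1
  have : block E V e z a l ⊆ (e l).erase x := by
    intro w hw
    refine mem_erase.2 ⟨fun h => hxb (h ▸ hw), (mem_filter.1 hw).2.2.1⟩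
  have := card_le_card this
  rwa [card_erase_of_mem hx, h4 _ (he.mem l hl)] at this

lemma le_sum_card_block (h4 : ∀ e ∈ E, e.card = 4)
    (hlin : ∀ e ∈ E, ∀ f ∈ E, e ≠ f → (e ∩ f).card ≤ 1) (hj : 0 < j) (hjk : j < k)
    (he : IsPath E j e) (hmax : ∀ p, ¬ IsPath E (j + 1) p) {z : α} (hz : z ∈ e (j - 1))
    (hz' : ∀ i, i + 1 < j → z ∉ e i) (hdeg : 5 * k < 2 * (E.filter (z ∈ ·)).card) (a : α) :
    2 * k ≤ ∑ l ∈ range (j - 2), (block E (verts j e) e z a l).card := by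
  have hsub : ends E (verts j e) z ⊆
      (range (j - 2)).biUnion (block E (verts j e) e z a) ∪ insert a (e (j - 2)) := by
    intro w hw
    by_cases hwa : w = a
    · simp [hwa]
    obtain ⟨hwV, hwz, f, hf, hfV⟩ := mem_filter.1 hw
    have hex := mem_verts.1 hwV
    classical
    obtain ⟨hlj, hl⟩ := Nat.find_spec hex
    have hmin := fun t => @Nat.find_min _ _ hex t
    set l := Nat.find hex
    have hne : l ≠ j - 1 := by
      intro h
      rw [h] at hl
      have hfw : w ∈ f ∧ z ∈ f := by
        have h1 : w ∈ f ∩ verts j e := by simp [hfV]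
        have h2 : z ∈ f ∩ verts j e := by simp [hfV]
        exact ⟨(mem_inter.1 h1).1, (mem_inter.1 h2).1⟩
      obtain rfl := eq_of_two_mem hlin hf (he.mem (j - 1) (by omega)) hwz hfw.1 hl hfw.2 hz
      have h2 : e (j - 1) ∩ verts j e = e (j - 1) :=
        inter_eq_left.2 fun x hx => mem_verts.2 ⟨j - 1, by omega, hx⟩
      have h3 := card_le_two (a := z) (b := w)
      rw [← hfV, h2, h4 _ hf] at h3
      omega
    by_cases hl2 : l = j - 2
    · rw [← hl2]
      simp [hl]
    · refine mem_union_left _ (mem_biUnion.2 ⟨l, mem_range.2 (by omega), ?_⟩)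
      exact mem_filter.2 ⟨hw, hwa, hl, fun i hi hwi => hmin i hi ⟨by omega, hwi⟩⟩
  have h1 := (card_le_card hsub).trans (card_union_le _ _)
  have h2 := card_insert_le a (e (j - 2))
  rw [h4 _ (he.mem (j - 2) (by omega))] at h2
  have h3 := card_biUnion_le (s := range (j - 2)) (t := block E (verts j e) e z a)
  have h5 := degree_le_card_ends h4 hlin hj he hmax hz hz'
  omega

/-- Of three edges meeting `V` in `a` and one further vertex, one is disjoint from an edge `f`
that has at most two vertices outside `V`. -/
lemma exists_disjoint_of_three (hlin : ∀ e ∈ E, ∀ f ∈ E, e ≠ f → (e ∩ f).card ≤ 1)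
    {V f B : Finset α} {a : α} (hfV : (f \ V).card ≤ 2) (haV : a ∈ V) (haf : a ∉ f)
    (hB : 3 ≤ B.card) (hBf : ∀ w ∈ B, w ∉ f) (hBE : ∀ w ∈ B, w ≠ a ∧ ∃ g ∈ E, g ∩ V = {a, w}) :
    ∃ w ∈ B, ∃ g ∈ E, g ∩ V = {a, w} ∧ Disjoint f g := by
  by_contra! hcon
  have hmeet : ∀ w ∈ B, ∃ o ∈ f \ V, ∃ g ∈ E, g ∩ V = {a, w} ∧ o ∈ g := by
    intro w hw
    obtain ⟨hwa, g, hg, hgV⟩ := hBE w hw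
    obtain ⟨o, hof, hog⟩ := not_disjoint_iff.1 (hcon w hw g hg hgV)
    refine ⟨o, mem_sdiff.2 ⟨hof, fun hoV => ?_⟩, g, hg, hgV, hog⟩
    have : o ∈ ({a, w} : Finset α) := hgV ▸ mem_inter.2 ⟨hog, hoV⟩
    rw [mem_insert, mem_singleton] at this
    rcases this with rfl | rfl
    · exact haf hof
    · exact hBf _ hw hof
  choose! o ho g hg hgV hog using hmeet
  obtain ⟨x, hx, y, hy, hxy, hoxy⟩ :=
    exists_ne_map_eq_of_card_lt_of_maps_to (s := B) (t := f \ V) (by omega) ho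
  have hag : ∀ w ∈ B, a ∈ g w := fun w hw => by
    have : a ∈ g w ∩ V := by simp [hgV w hw]
    exact (mem_inter.1 this).1
  have heq : g x = g y := by
    refine eq_of_two_mem hlin (hg x hx) (hg y hy) (x := a) (y := o x) ?_ (hag x hx) (hag y hy)
      (hog x hx) (hoxy ▸ hog y hy)
    intro h
    exact (mem_sdiff.1 (ho x hx)).2 (h ▸ haV)
  have hpair : y ∈ ({a, x} : Finset α) := by
    rw [← hgV x hx, heq, hgV y hy]
    simp
  rw [mem_insert, mem_singleton] at hpair
  rcases hpair with h | h
  · exact (hBE y hy).1 h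
  · exact hxy h.symm

/-- Two crossing chords close a linear path with `j` edges to a linear cycle with `j + 1` edges. -/
lemma IsPath.isCycle_of_chords (he : IsPath E j e) {l : ℕ} (hl : l + 2 < j) {z a w w' : α}
    (hz : z ∈ e (j - 1)) (hz' : ∀ i, i + 1 < j → z ∉ e i)
    (ha : a ∈ e 0) (ha' : ∀ i, 0 < i → i < j → a ∉ e i)
    {f g : Finset α} (hf : f ∈ E) (hg : g ∈ E) (hfV : f ∩ verts j e = {z, w})
    (hgV : g ∩ verts j e = {a, w'}) (hfg : Disjoint f g)
    (hw : w ∈ e l) (hwl : ∀ i < l, w ∉ e i) (hw' : w' ∈ e (l + 2))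
    (hwl' : ∀ i, l + 2 < i → i < j → w' ∉ e i) :
    IsCycle E (j + 1) (fun i => if i ≤ l then e i else if i = l + 1 then f
      else if i < j then e (j + 1 + l - i) else g) := by
  have hf_iff : ∀ i < j, ∀ x ∈ e i, (x ∈ f ↔ x = z ∨ x = w) := by
    intro i hi x hx
    rw [← mem_singleton (a := w), ← mem_insert, ← hfV, mem_inter,
      and_iff_left (mem_verts.2 ⟨i, hi, hx⟩)]
  have hg_iff : ∀ i < j, ∀ x ∈ e i, (x ∈ g ↔ x = a ∨ x = w') := by
    intro i hi x hx
    rw [← mem_singleton (a := w'), ← mem_insert, ← hgV, mem_inter,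
      and_iff_left (mem_verts.2 ⟨i, hi, hx⟩)]
  have hwd : ∀ i, l + 2 ≤ i → i < j → w ∉ e i := fun i h1 h2 =>
    disjoint_left.1 (he.disj l i h1 h2) hw
  have hwd' : ∀ i, i ≤ l → w' ∉ e i := fun i h1 =>
    disjoint_right.1 (he.disj i (l + 2) (by omega) hl) hw'
  have hfl : (e l ∩ f).card = 1 := by
    rw [card_eq_one]
    refine ⟨w, ?_⟩
    ext x
    have := hf_iff l (by omega) x
    have := hz' l (by omega)
    grind
  have hfz : (f ∩ e (j - 1)).card = 1 := by
    rw [card_eq_one]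
    refine ⟨z, ?_⟩
    ext x
    have := hf_iff (j - 1) (by omega) x
    have := hwd (j - 1) (by omega) (by omega)
    grind
  have hgl : (e (l + 2) ∩ g).card = 1 := by
    rw [card_eq_one]
    refine ⟨w', ?_⟩
    ext x
    have := hg_iff (l + 2) (by omega) x
    have := ha' (l + 2) (by omega) hl
    grind
  have hga : (g ∩ e 0).card = 1 := by
    rw [card_eq_one]
    refine ⟨a, ?_⟩
    ext x
    have := hg_iff 0 (by omega) x
    have := hwd' 0 (by omega)
    grind
  have hfd : ∀ i, i < l → Disjoint (e i) f := by
    intro i hi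
    rw [disjoint_left]
    intro x hx
    have := hf_iff i (by omega) x hx
    have := hz' i (by omega)
    have := hwl i hi
    grind
  have hfd' : ∀ i, l + 2 ≤ i → i + 1 < j → Disjoint f (e i) := by
    intro i hi hij
    rw [disjoint_right]
    intro x hx
    have := hf_iff i (by omega) x hx
    have := hz' i (by omega)
    have := hwd i hi (by omega)
    grind
  have hgd : ∀ i, 0 < i → i ≤ l → Disjoint (e i) g := by
    intro i hi hil
    rw [disjoint_left]
    intro x hx
    have := hg_iff i (by omega) x hx
    have := ha' i hi (by omega)
    have := hwd' i hil
    grind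
  have hgd' : ∀ i, l + 2 < i → i < j → Disjoint (e i) g := by
    intro i hi hij
    rw [disjoint_left]
    intro x hx
    have := hg_iff i (by omega) x hx
    have := ha' i (by omega) hij
    have := hwl' i hi hij
    grind
  refine ⟨fun i hi => ?_, fun i hi => ?_, ?_, fun i i' hi hi' hne => ?_⟩
  · split_ifs
    · exact he.mem _ (by omega)
    · exact hf
    · exact he.mem _ (by omega)
    · exact hg
  · split_ifs <;> first | omega | skip
    · exact he.card_inter i (by omega)
    · rwa [show i = l by omega]
    · rwa [show j + 1 + l - (i + 1) = j - 1 by omega]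
    · rw [inter_comm, show j + 1 + l - i = j + 1 + l - (i + 1) + 1 by omega]
      exact he.card_inter _ (by omega)
    · rwa [show j + 1 + l - i = l + 2 by omega]
  · simpa [show ¬ (j ≤ l) by omega, show j ≠ l + 1 by omega] using hga
  · split_ifs <;> first | omega | skip
    · exact he.disj _ _ hi (by omega)
    · exact hfd i (by omega)
    · exact he.disj _ _ (by omega) (by omega)
    · exact hgd i (by omega) (by omega)
    · exact hfd' _ (by omega) (by omega)
    · exact (he.disj _ _ (by omega) (by omega)).symm
    · exact hgd' _ (by omega) (by omega)

lemma IsPath.exists_end (h4 : ∀ e ∈ E, e.card = 4) (hj : 0 < j) (he : IsPath E j e) :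
    ∃ z ∈ e (j - 1), ∀ i, i + 1 < j → z ∉ e i := by
  obtain ⟨z, hz, hz'⟩ : ∃ z ∈ e (j - 1), 1 < j → z ∉ e (j - 2) := by
    have hc := h4 _ (he.mem (j - 1) (by omega))
    by_cases h : 1 < j
    · have h1 := he.card_inter (j - 2) (by omega)
      rw [show j - 2 + 1 = j - 1 by omega, inter_comm] at h1
      have h2 := card_sdiff_add_card_inter (e (j - 1)) (e (j - 2))
      obtain ⟨z, hz⟩ := card_pos.1 (show 0 < (e (j - 1) \ e (j - 2)).card by omega)
      rw [mem_sdiff] at hz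
      exact ⟨z, hz.1, fun _ => hz.2⟩
    · obtain ⟨z, hz⟩ := card_pos.1 (show 0 < (e (j - 1)).card by omega)
      exact ⟨z, hz, fun h' => absurd h' h⟩
  refine ⟨z, hz, fun i hi => ?_⟩
  by_cases h : i = j - 2
  · exact h ▸ hz' (by omega)
  · exact disjoint_right.1 (he.disj i (j - 1) (by omega) (by omega)) hz

/-- Under a minimum degree condition a maximal linear path closes to a longer linear cycle. -/
lemma IsPath.exists_cycle (h4 : ∀ e ∈ E, e.card = 4)
    (hlin : ∀ e ∈ E, ∀ f ∈ E, e ≠ f → (e ∩ f).card ≤ 1) (hj : 0 < j) (hjk : j < k)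
    (he : IsPath E j e) (hmax : ∀ p, ¬ IsPath E (j + 1) p)
    (hdeg : ∀ f ∈ E, ∀ z ∈ f, 5 * k < 2 * (E.filter (z ∈ ·)).card) :
    3 ≤ j ∧ ∃ c, IsCycle E (j + 1) c := by
  obtain ⟨z, hz, hz'⟩ := he.exists_end h4 hj
  obtain ⟨a, ha, ha'⟩ := he.reverse.exists_end h4 hj
  have hsz := le_sum_card_block h4 hlin hj hjk he hmax hz hz'
    (hdeg _ (he.mem _ (by omega)) z hz) a
  have hsa := le_sum_card_block h4 hlin hj hjk he.reverse hmax ha ha'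
    (hdeg _ (he.reverse.mem _ (by omega)) a ha) z
  rw [verts_reverse] at hsa
  have hj3 : 3 ≤ j := by
    by_contra hlt
    rw [show j - 2 = 0 by omega, range_zero, sum_empty] at hsz
    omega
  refine ⟨hj3, ?_⟩
  rw [← sum_range_reflect] at hsa
  obtain ⟨l, hl, hl5⟩ : ∃ l ∈ range (j - 2), 4 < (block E (verts j e) e z a l).card +
      (block E (verts j e) (fun i => e (j - 1 - i)) a z (j - 2 - 1 - l)).card := by
    refine exists_lt_of_sum_lt ?_
    rw [sum_add_distrib, sum_const, card_range, smul_eq_mul]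
    omega
  rw [mem_range] at hl
  rw [Nat.sub_self] at ha
  replace ha' : ∀ i, 0 < i → i < j → a ∉ e i := fun i hi hij => by
    have := ha' (j - 1 - i) (by omega)
    rwa [show j - 1 - (j - 1 - i) = i by omega] at this
  have hA := card_block_le h4 he (V := verts j e) (z := z) ha (l := l) (by omega)
  have hB := card_block_le h4 he.reverse (V := verts j e) (z := a) (a := z) (by simpa using hz)
    (l := j - 2 - 1 - l) (by omega)
  set A := block E (verts j e) e z a l
  set B := block E (verts j e) (fun i => e (j - 1 - i)) a z (j - 2 - 1 - l)
  have hAmem : ∀ w ∈ A, w ≠ a ∧ w ∈ e l ∧ (∀ i < l, w ∉ e i) ∧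
      w ≠ z ∧ ∃ f ∈ E, f ∩ verts j e = {z, w} := by
    intro w hw
    obtain ⟨h1, h2, h3, h5⟩ := mem_filter.1 hw
    exact ⟨h2, h3, h5, (mem_filter.1 h1).2⟩
  have hBmem : ∀ w ∈ B, w ≠ z ∧ w ∈ e (l + 2) ∧ (∀ i, l + 2 < i → i < j → w ∉ e i) ∧
      w ≠ a ∧ ∃ g ∈ E, g ∩ verts j e = {a, w} := by
    intro w hw
    obtain ⟨h1, h2, h3, h5⟩ := mem_filter.1 hw
    refine ⟨h2, ?_, fun i hi hij => ?_, (mem_filter.1 h1).2⟩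
    · beta_reduce at h3
      rwa [show j - 1 - (j - 2 - 1 - l) = l + 2 by omega] at h3
    · have := h5 (j - 1 - i) (by omega)
      beta_reduce at this
      rwa [show j - 1 - (j - 1 - i) = i by omega] at this
  have hAB : ∀ w ∈ A, ∀ w' ∈ B, w ≠ w' := by
    rintro w hw w' hw' rfl
    exact disjoint_left.1 (he.disj l (l + 2) le_rfl (by omega)) (hAmem w hw).2.1
      (hBmem w hw').2.1
  have hza : z ≠ a := by
    rintro rfl
    exact hz' 0 (by omega) ha
  have hzV : z ∈ verts j e := mem_verts.2 ⟨j - 1, by omega, hz⟩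
  have haV : a ∈ verts j e := mem_verts.2 ⟨0, by omega, ha⟩
  have hAV : ∀ w ∈ A, w ∈ verts j e := fun w hw => mem_verts.2 ⟨l, by omega, (hAmem w hw).2.1⟩
  have hBV : ∀ w ∈ B, w ∈ verts j e := fun w hw =>
    mem_verts.2 ⟨l + 2, by omega, (hBmem w hw).2.1⟩
  have hout : ∀ f ∈ E, ∀ x y, x ≠ y → f ∩ verts j e = {x, y} → (f \ verts j e).card ≤ 2 := by
    intro f hf x y hxy hfV
    have := card_sdiff_add_card_inter f (verts j e)
    rw [hfV, card_pair hxy, h4 f hf] at this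
    omega
  have hnot : ∀ f x y v, f ∩ verts j e = {x, y} → v ∈ verts j e → v ≠ x → v ≠ y → v ∉ f := by
    intro f x y v hfV hv hx hy hvf
    have : v ∈ ({x, y} : Finset α) := hfV ▸ mem_inter.2 ⟨hvf, hv⟩
    simp [hx, hy] at this
  obtain ⟨w, hw, w', hw', f, hf, g, hg, hfV, hgV, hfg⟩ : ∃ w ∈ A, ∃ w' ∈ B, ∃ f ∈ E, ∃ g ∈ E,
      f ∩ verts j e = {z, w} ∧ g ∩ verts j e = {a, w'} ∧ Disjoint f g := by
    by_cases hB3 : 3 ≤ B.card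
    · obtain ⟨w, hw⟩ := card_pos.1 (show 0 < A.card by omega)
      obtain ⟨hwa, -, -, hwz, f, hf, hfV⟩ := hAmem w hw
      obtain ⟨w', hw', g, hg, hgV, hfg⟩ := exists_disjoint_of_three hlin
        (hout f hf z w hwz.symm hfV) haV (hnot f z w a hfV haV hza.symm hwa.symm) hB3
        (fun w' hw' => hnot f z w w' hfV (hBV w' hw') (hBmem w' hw').1 (hAB w hw w' hw').symm)
        (fun w' hw' => (hBmem w' hw').2.2.2)
      exact ⟨w, hw, w', hw', f, hf, g, hg, hfV, hgV, hfg⟩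
    · obtain ⟨w', hw'⟩ := card_pos.1 (show 0 < B.card by omega)
      obtain ⟨hwz, -, -, hwa, g, hg, hgV⟩ := hBmem w' hw'
      obtain ⟨w, hw, f, hf, hfV, hfg⟩ := exists_disjoint_of_three hlin
        (hout g hg a w' hwa.symm hgV) hzV (hnot g a w' z hgV hzV hza hwz.symm)
        (show 3 ≤ A.card by omega)
        (fun w hw => hnot g a w' w hgV (hAV w hw) (hAmem w hw).1 (hAB w hw w' hw'))
        (fun w hw => (hAmem w hw).2.2.2)
      exact ⟨w, hw, w', hw', f, hf, g, hg, hfV, hgV, hfg.symm⟩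
  exact ⟨_, he.isCycle_of_chords (by omega) hz hz' ha ha' hf hg hfV hgV hfg (hAmem w hw).2.1
    (hAmem w hw).2.2.1 (hBmem w' hw').2.1 (hBmem w' hw').2.2.1⟩

/-- In a linear system, edges meeting `S` in at least two vertices are determined by a pair. -/
lemma two_mul_card_le_of_two_le_inter (hlin : ∀ e ∈ E, ∀ f ∈ E, e ≠ f → (e ∩ f).card ≤ 1)
    {S : Finset α} (hS : ∀ f ∈ E, 2 ≤ (f ∩ S).card) : 2 * E.card ≤ S.card * (S.card - 1) := by
  choose! p hp hp2 using fun f hf => exists_subset_card_eq (hS f hf)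
  have hle : E.card ≤ (powersetCard 2 S).card := by
    refine card_le_card_of_injOn p (fun f hf => ?_) (fun f hf g hg hfg => ?_)
    · exact mem_powersetCard.2 ⟨(hp f hf).trans inter_subset_right, hp2 f hf⟩
    · obtain ⟨x, hx, y, hy, hxy⟩ := one_lt_card.1 (show 1 < (p f).card by rw [hp2 f hf]; omega)
      have hx' := hp g hg (hfg ▸ hx)
      have hy' := hp g hg (hfg ▸ hy)
      exact eq_of_two_mem hlin hf hg hxy (mem_inter.1 (hp f hf hx)).1 (mem_inter.1 hx').1
        (mem_inter.1 (hp f hf hy)).1 (mem_inter.1 hy').1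
  rw [card_powersetCard, Nat.choose_two_right] at hle
  have := Nat.div_mul_le_self (S.card * (S.card - 1)) 2
  omega

/-- If every nonempty set of vertices meets many edges, then there is a linear path. -/
lemma exists_path_of_dense (h4 : ∀ e ∈ E, e.card = 4)
    (hlin : ∀ e ∈ E, ∀ f ∈ E, e ≠ f → (e ∩ f).card ≤ 1) (hE : E.Nonempty)
    (hdense : ∀ S : Finset α, S.Nonempty → (∀ v ∈ S, ∃ f ∈ E, v ∈ f) →
      5 * k * S.card < 2 * (E.filter fun f => ¬ Disjoint f S).card)
    (hj : 0 < j) (hjk : j ≤ k) : ∃ e, IsPath E j e := by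
  induction j, hj using Nat.le_induction with
  | base =>
    obtain ⟨f, hf⟩ := hE
    exact ⟨fun _ => f, fun _ _ => hf, fun _ _ => by omega, fun _ _ _ _ => by omega⟩
  | succ j hj ih =>
    obtain ⟨e, he⟩ := ih (by omega)
    by_contra! hmax
    obtain ⟨hj3, c, hc⟩ := he.exists_cycle h4 hlin hj hjk hmax fun f hf z hz => by
      simpa using hdense {z} (by simp) (by simpa using ⟨f, hf, hz⟩)
    have hcard : (verts (j + 1) c).card ≤ (j + 1) * 4 := by
      simpa [verts] using card_biUnion_le_card_mul (range (j + 1)) c 4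
        fun i hi => (h4 _ (hc.mem i (mem_range.1 hi))).le
    have hne : (verts (j + 1) c).Nonempty := by
      obtain ⟨v, hv⟩ := card_pos.1 (show 0 < (c 0).card by rw [h4 _ (hc.mem 0 (by omega))]; omega)
      exact ⟨v, mem_verts.2 ⟨0, by omega, hv⟩⟩
    have hlow := hdense _ hne fun v hv => by
      obtain ⟨i, hi, hvi⟩ := mem_verts.1 hv
      exact ⟨c i, hc.mem i hi, hvi⟩
    have hup := two_mul_card_le_of_two_le_inter (S := verts (j + 1) c)
      (E := E.filter fun f => ¬ Disjoint f (verts (j + 1) c))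
      (fun f hf g hg => hlin f (mem_filter.1 hf).1 g (mem_filter.1 hg).1) fun f hf => by
        obtain ⟨hfE, hfS⟩ := mem_filter.1 hf
        rw [disjoint_iff_inter_eq_empty, ← card_eq_zero] at hfS
        by_contra hlt
        obtain ⟨v, hv⟩ := card_eq_one.1 (show (f ∩ verts (j + 1) c).card = 1 by omega)
        obtain ⟨p, hp⟩ := hc.exists_path (by omega) hfE hv
        exact hmax p hp
    have : (verts (j + 1) c).card * ((verts (j + 1) c).card - 1) ≤
        (verts (j + 1) c).card * (5 * k) := Nat.mul_le_mul_left _ (by omega)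
    rw [mul_comm _ (5 * k)] at this
    omega

lemma two_mul_card_filter_subset_le (h4 : ∀ e ∈ E, e.card = 4)
    (hlin : ∀ e ∈ E, ∀ f ∈ E, e ≠ f → (e ∩ f).card ≤ 1) (hk : 0 < k)
    (hfree : ∀ e, ¬ IsPath E k e) (U : Finset α) :
    2 * (E.filter (· ⊆ U)).card ≤ 5 * k * U.card := by
  induction U using Finset.strongInduction with
  | H U ih =>
    by_contra! hlt
    have hsub : E.filter (· ⊆ U) ⊆ E := filter_subset _ _
    suffices hdense : ∀ S : Finset α, S.Nonempty → (∀ v ∈ S, ∃ f ∈ E.filter (· ⊆ U), v ∈ f) →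
        5 * k * S.card < 2 * ((E.filter (· ⊆ U)).filter fun f => ¬ Disjoint f S).card by
      obtain ⟨e, he⟩ := exists_path_of_dense (fun f hf => h4 f (hsub hf))
        (fun f hf g hg => hlin f (hsub hf) g (hsub hg)) (card_pos.1 (by omega)) hdense hk le_rfl
      exact hfree e ⟨fun i hi => hsub (he.mem i hi), he.card_inter, he.disj⟩
    intro S hS hSE
    have hSU : S ⊆ U := fun v hv => by
      obtain ⟨f, hf, hvf⟩ := hSE v hv
      exact (mem_filter.1 hf).2 hvf
    have hrest := ih (U \ S) (sdiff_ssubset hSU hS)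
    have heq : (E.filter (· ⊆ U)).filter (fun f => Disjoint f S) = E.filter (· ⊆ U \ S) := by
      ext f
      simp only [mem_filter, subset_sdiff, and_assoc]
    have hsplit := card_filter_add_card_filter_not (s := E.filter (· ⊆ U))
      (fun f => Disjoint f S)
    rw [heq] at hsplit
    have hcard : 5 * k * (U \ S).card + 5 * k * S.card = 5 * k * U.card := by
      rw [← mul_add, card_sdiff_add_card_eq_card hSU]
    omega

end LinearPath

/-- every `P_k`-free linear quadruple system on `n` vertices has at most
`2.5 k n` quadruples (stated as `2 · |E(H)| ≤ 5kn`). -/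
theorem linear_turan_Pk_upper (n k : ℕ) (hn : 0 < n) (hk : 0 < k)
    (H : LinearQuadSystem n) (hfree : ¬ ContainsPath k H) :
    2 * H.edges.card ≤ 5 * k * n := by
  have h := LinearPath.two_mul_card_filter_subset_le (k := k) H.card_four H.linear hk
    (fun e he => hfree ⟨fun i => e i, fun i => he.mem i i.2,
      fun i j hij => by simpa [hij] using he.card_inter i (hij ▸ j.2),
      fun i j hij => Finset.disjoint_iff_inter_eq_empty.1 (he.disj i j hij j.2)⟩) Finset.univ
  simpa using h
end

section
/- Let n, k be positive integers with n > 37(k−1)^2 + 3. Then ex^lin_4(n, M_k) = g(n, k), where M_k is the 4-matching consisting of k pairwise disjoint quadruples and g(n, k) denotes the maximum number of quadruples that can intersect a fixed (k−1)-element vertex subset in a linear quadruple system on n vertices. -/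
/-- `H` contains the 4-matching `M_k`: `k` pairwise disjoint quadruples. -/
def ContainsMatching {n : ℕ} (k : ℕ) (H : LinearQuadSystem n) : Prop :=
  ∃ e : Fin k → Finset (Fin n),
    (∀ i, e i ∈ H.edges) ∧ ∀ i j, i ≠ j → Disjoint (e i) (e j)

/-- `g n k`: the maximum, over linear quadruple systems `H` on `n` vertices and
`(k-1)`-element vertex subsets `A`, of the number of quadruples of `H` meeting `A`. -/
noncomputable def g (n k : ℕ) : ℕ :=
  sSup {m | ∃ H : LinearQuadSystem n, ∃ A : Finset (Fin n), A.card = k - 1 ∧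
    (H.edges.filter (fun e => (e ∩ A).Nonempty)).card = m}

namespace LinearQuadSystem

variable {n : ℕ}

open Finset

/-- The quadruples of `H` through the vertex `v`. -/
def star (H : LinearQuadSystem n) (v : Fin n) : Finset (Finset (Fin n)) :=
  H.edges.filter (v ∈ ·)

lemma mem_star {H : LinearQuadSystem n} {v : Fin n} {e : Finset (Fin n)} :
    e ∈ H.star v ↔ e ∈ H.edges ∧ v ∈ e := mem_filter

lemma eq_of_mem (H : LinearQuadSystem n) {e f : Finset (Fin n)} (he : e ∈ H.edges)
    (hf : f ∈ H.edges) {u v : Fin n} (huv : u ≠ v) (hue : u ∈ e) (hve : v ∈ e)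
    (huf : u ∈ f) (hvf : v ∈ f) : e = f := by
  by_contra hne
  exact huv (card_le_one.mp (H.linear e he f hf hne) u (mem_inter.2 ⟨hue, huf⟩) v
    (mem_inter.2 ⟨hve, hvf⟩))

/-- The restriction of a linear quadruple system to a subfamily of quadruples. -/
def restrict (H : LinearQuadSystem n) (p : Finset (Fin n) → Prop) [DecidablePred p] :
    LinearQuadSystem n where
  edges := H.edges.filter p
  card_four e he := H.card_four e (mem_filter.1 he).1
  linear e he f hf := H.linear e (mem_filter.1 he).1 f (mem_filter.1 hf).1

lemma card_star_le (H : LinearQuadSystem n) (v : Fin n) : (H.star v).card ≤ (n - 1) / 3 := by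
  have hdisj : (H.star v : Set (Finset (Fin n))).PairwiseDisjoint (fun e => e.erase v) := by
    intro e he f hf hne
    rw [Function.onFun, disjoint_left]
    intro u hu hu'
    have he := mem_star.1 (mem_coe.1 he)
    have hf := mem_star.1 (mem_coe.1 hf)
    exact hne (H.eq_of_mem he.1 hf.1 (ne_of_mem_erase hu) (mem_of_mem_erase hu) he.2
      (mem_of_mem_erase hu') hf.2)
  have hcard := card_biUnion hdisj
  have hthree : ∀ e ∈ H.star v, (e.erase v).card = 3 := fun e he => by
    rw [card_erase_of_mem (mem_star.1 he).2, H.card_four e (mem_star.1 he).1]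
  rw [sum_const_nat hthree] at hcard
  have hle : ((H.star v).biUnion fun e => e.erase v).card ≤ (univ.erase v).card :=
    card_le_card fun u hu => by
      obtain ⟨e, -, hu⟩ := mem_biUnion.1 hu
      exact mem_erase.2 ⟨ne_of_mem_erase hu, mem_univ u⟩
  rw [card_erase_of_mem (mem_univ v), card_univ, Fintype.card_fin] at hle
  omega

lemma exists_mem_star_disjoint (H : LinearQuadSystem n) {v : Fin n} {W : Finset (Fin n)}
    (hv : v ∉ W) (hW : W.card < (H.star v).card) : ∃ e ∈ H.star v, Disjoint e W := by
  by_contra! hcon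
  refine hW.not_ge ?_
  have hsub : H.star v ⊆ W.biUnion fun w => (H.star v).filter (w ∈ ·) := fun e he => by
    obtain ⟨w, hwe, hw⟩ := not_disjoint_iff.1 (hcon e he)
    exact mem_biUnion.2 ⟨w, hw, mem_filter.2 ⟨he, hwe⟩⟩
  refine (card_le_card hsub).trans ((card_biUnion_le_card_mul _ _ 1 fun w hw => ?_).trans
    (mul_one _).le)
  refine card_le_one.2 fun e he f hf => ?_
  obtain ⟨he, hwe⟩ := mem_filter.1 he
  obtain ⟨hf, hwf⟩ := mem_filter.1 hf
  exact H.eq_of_mem (mem_star.1 he).1 (mem_star.1 hf).1 (ne_of_mem_of_not_mem hw hv) hwe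
    (mem_star.1 he).2 hwf (mem_star.1 hf).2

lemma containsMatching_of_finset {H : LinearQuadSystem n} {M : Finset (Finset (Fin n))}
    (hM : M ⊆ H.edges) (hdisj : (M : Set (Finset (Fin n))).PairwiseDisjoint id) :
    ContainsMatching M.card H :=
  ⟨fun i => M.equivFin.symm i, fun i => hM (M.equivFin.symm i).2, fun i j hij =>
    hdisj (M.equivFin.symm i).2 (M.equivFin.symm j).2 fun h =>
      hij (M.equivFin.symm.injective (Subtype.ext h))⟩

/-- A matching avoiding a set `B` of vertices of large degree can be extended by one quadruple
through each vertex of `B`. -/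
lemma containsMatching_of_large_degree (H : LinearQuadSystem n) {s : ℕ} (B : Finset (Fin n)) :
    (∀ v ∈ B, 4 * s < (H.star v).card) → ∀ M ⊆ H.edges,
      (M : Set (Finset (Fin n))).PairwiseDisjoint id → (∀ e ∈ M, Disjoint e B) →
      M.card + B.card = s + 1 → ContainsMatching (s + 1) H := by
  induction B using Finset.induction_on with
  | empty =>
    intro _ M hM hdisj _ hcard
    rw [card_empty, add_zero] at hcard
    exact hcard ▸ containsMatching_of_finset hM hdisj
  | insert a B ha ih =>
    intro hdeg M hM hdisj hMB hcard
    rw [card_insert_of_notMem ha] at hcard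
    have hMa : ∀ e ∈ M, a ∉ e := fun e he hae =>
      disjoint_left.1 (hMB e he) hae (mem_insert_self a B)
    have hV : (M.biUnion id).card ≤ M.card * 4 :=
      card_biUnion_le_card_mul _ _ _ fun e he => (H.card_four e (hM he)).le
    have hW := card_union_le B (M.biUnion id)
    have hda := hdeg a (mem_insert_self a B)
    obtain ⟨e, he, heW⟩ := H.exists_mem_star_disjoint (v := a) (W := B ∪ M.biUnion id)
      (by simpa [ha] using hMa) (by omega)
    obtain ⟨he, hae⟩ := mem_star.1 he
    rw [disjoint_union_right, disjoint_biUnion_right] at heW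
    refine ih (fun v hv => hdeg v (mem_insert_of_mem hv)) (insert e M)
      (insert_subset he hM) ?_ ?_ ?_
    · rw [coe_insert]
      exact hdisj.insert fun f hf _ => heW.2 f hf
    · intro f hf
      rcases mem_insert.1 hf with rfl | hf
      · exact heW.1
      · exact (hMB f hf).mono_right (subset_insert a B)
    · rw [card_insert_of_notMem fun h => hMa e h hae]
      omega

/-- If every matching in a subfamily `E` has at most `t` quadruples and all degrees of vertices
covered by `E` are at most `d + 1`, then `E` has at most `t * (1 + 4 * d)` quadruples. -/
lemma card_le_of_matching_bound (H : LinearQuadSystem n) {E : Finset (Finset (Fin n))}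
    (hE : E ⊆ H.edges) {t d : ℕ}
    (hmatch : ∀ M ⊆ E, (M : Set (Finset (Fin n))).PairwiseDisjoint id → M.card ≤ t)
    (hdeg : ∀ e ∈ E, ∀ v ∈ e, (H.star v).card ≤ d + 1) : E.card ≤ t * (1 + 4 * d) := by
  classical
  obtain ⟨M, hM, hmax⟩ := exists_max_image
    (E.powerset.filter fun M : Finset (Finset (Fin n)) => (M : Set (Finset (Fin n))).PairwiseDisjoint id) card
    ⟨∅, by simp⟩
  obtain ⟨hME, hdisj⟩ := mem_filter.1 hM
  rw [mem_powerset] at hME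
  have hsub : E ⊆ M.biUnion fun f => insert f (f.biUnion fun v => (H.star v).erase f) := by
    intro e he
    by_cases heM : e ∈ M
    · exact mem_biUnion.2 ⟨e, heM, mem_insert_self _ _⟩
    by_contra hcon
    have hnew : ∀ f ∈ M, Disjoint e f := fun f hf => by
      by_contra h
      obtain ⟨v, hve, hvf⟩ := not_disjoint_iff.1 h
      exact hcon (mem_biUnion.2 ⟨f, hf, mem_insert_of_mem (mem_biUnion.2 ⟨v, hvf,
        mem_erase.2 ⟨fun h => heM (h ▸ hf), mem_star.2 ⟨hE he, hve⟩⟩⟩)⟩)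
    have hle := hmax (insert e M) (mem_filter.2 ⟨mem_powerset.2 (insert_subset he hME), by
      rw [coe_insert]
      exact hdisj.insert fun f hf _ => hnew f hf⟩)
    rw [card_insert_of_notMem heM] at hle
    omega
  refine (card_le_card hsub).trans ((card_biUnion_le_card_mul _ _ (1 + 4 * d) fun f hf => ?_).trans
    (Nat.mul_le_mul_right _ (hmatch M hME hdisj)))
  have hfour := H.card_four f (hE (hME hf))
  have hf' : (f.biUnion fun v => (H.star v).erase f).card ≤ f.card * d :=
    card_biUnion_le_card_mul _ _ _ fun v hv => by
      rw [card_erase_of_mem (mem_star.2 ⟨hE (hME hf), hv⟩)]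
      have := hdeg f (hME hf) v hv
      omega
  have := card_insert_le f (f.biUnion fun v => (H.star v).erase f)
  rw [hfour] at hf'
  omega

lemma not_containsMatching_of_cover {H : LinearQuadSystem n} {k : ℕ} {A : Finset (Fin n)}
    (hA : A.card < k) (hcover : ∀ e ∈ H.edges, (e ∩ A).Nonempty) : ¬ ContainsMatching k H := by
  rintro ⟨e, he, hdisj⟩
  choose f hf using fun i => hcover (e i) (he i)
  obtain ⟨i, -, j, -, hij, hfij⟩ := exists_ne_map_eq_of_card_lt_of_maps_to
    (s := (univ : Finset (Fin k))) (t := A) (by simpa using hA) (f := f)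
    (fun i _ => (mem_inter.1 (hf i)).2)
  exact disjoint_left.1 (hdisj i j hij) (mem_inter.1 (hf i)).1
    (hfij ▸ (mem_inter.1 (hf j)).1)

/-- Reduction modulo `m` for `y < 2 * m`. -/
def wrap (m y : ℕ) : ℕ := if y < m then y else y - m

/-- The `c`-th vertex of the quadruple with parameters `i` and `x` in a truncated transversal
design: one vertex in `[0, s)`, and one in each of three consecutive groups of size `m`. -/
def designVertex (s m i x : ℕ) : Fin 4 → ℕ :=
  ![i, s + x, s + m + wrap m (x + i), s + 2 * m + wrap m (x + 2 * i)]

section design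

variable {s m i j x y : ℕ}

lemma designVertex_lt (hs : 2 * s ≤ m) (hi : i < s) (hx : x < m) (c : Fin 4) :
    designVertex s m i x c < s + 3 * m := by
  fin_cases c <;> simp [designVertex, wrap] <;> grind

lemma designVertex_index_eq (hs : 2 * s ≤ m) (hi : i < s) (hj : j < s) (hx : x < m) (hy : y < m)
    {c d : Fin 4} (h : designVertex s m i x c = designVertex s m j y d) : c = d := by
  fin_cases c <;> fin_cases d <;> simp [designVertex, wrap] at h ⊢ <;> grind

lemma designVertex_params_eq (hs : 2 * s ≤ m) (hi : i < s) (hj : j < s) (hx : x < m) (hy : y < m)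
    {c d : Fin 4} (hcd : c ≠ d) (hc : designVertex s m i x c = designVertex s m j y c)
    (hd : designVertex s m i x d = designVertex s m j y d) : i = j ∧ x = y := by
  fin_cases c <;> fin_cases d <;> simp [designVertex, wrap] at hcd hc hd <;> grind

/-- The quadruple of the truncated transversal design with parameters `p`. -/
def designEdge (hs : 2 * s ≤ m) (hn : s + 3 * m ≤ n) (p : Fin s × Fin m) : Finset (Fin n) :=
  univ.image fun c : Fin 4 =>
    ⟨designVertex s m p.1 p.2 c, (designVertex_lt hs p.1.2 p.2.2 c).trans_le hn⟩

lemma designEdge_eq_of_mem (hs : 2 * s ≤ m) (hn : s + 3 * m ≤ n) {p q : Fin s × Fin m}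
    {u v : Fin n} (huv : u ≠ v) (hup : u ∈ designEdge hs hn p) (hvp : v ∈ designEdge hs hn p)
    (huq : u ∈ designEdge hs hn q) (hvq : v ∈ designEdge hs hn q) : p = q := by
  simp only [designEdge, mem_image, mem_univ, true_and] at hup hvp huq hvq
  obtain ⟨c, rfl⟩ := hup
  obtain ⟨d, rfl⟩ := hvp
  obtain ⟨c', hc⟩ := huq
  obtain ⟨d', hd⟩ := hvq
  rw [Fin.mk.injEq] at hc hd
  obtain rfl := designVertex_index_eq hs q.1.2 p.1.2 q.2.2 p.2.2 hc
  obtain rfl := designVertex_index_eq hs q.1.2 p.1.2 q.2.2 p.2.2 hd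
  have hne : c' ≠ d' := fun h => huv (by rw [h])
  obtain ⟨h₁, h₂⟩ := designVertex_params_eq hs q.1.2 p.1.2 q.2.2 p.2.2 hne hc hd
  exact Prod.ext (Fin.ext h₁.symm) (Fin.ext h₂.symm)

lemma card_designEdge (hs : 2 * s ≤ m) (hn : s + 3 * m ≤ n) (p : Fin s × Fin m) :
    (designEdge hs hn p).card = 4 := by
  rw [designEdge, card_image_of_injective, card_univ, Fintype.card_fin]
  intro c d h
  exact designVertex_index_eq hs p.1.2 p.1.2 p.2.2 p.2.2 (congrArg Fin.val h)

lemma designEdge_injective (hs : 2 * s ≤ m) (hn : s + 3 * m ≤ n) :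
    Function.Injective (designEdge hs hn) := by
  intro p q h
  obtain ⟨u, hu, v, hv, huv⟩ := one_lt_card.1
    (show 1 < (designEdge hs hn p).card by rw [card_designEdge]; norm_num)
  exact designEdge_eq_of_mem hs hn huv hu hv (h ▸ hu) (h ▸ hv)

/-- The truncated transversal design as a linear quadruple system. -/
def design (hs : 2 * s ≤ m) (hn : s + 3 * m ≤ n) : LinearQuadSystem n where
  edges := univ.image (designEdge hs hn)
  card_four e he := by
    obtain ⟨p, -, rfl⟩ := mem_image.1 he
    exact card_designEdge hs hn p
  linear e he f hf hne := by
    obtain ⟨p, -, rfl⟩ := mem_image.1 he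
    obtain ⟨q, -, rfl⟩ := mem_image.1 hf
    by_contra! h
    obtain ⟨u, hu, v, hv, huv⟩ := one_lt_card.1 h
    rw [mem_inter] at hu hv
    exact hne (congrArg _ (designEdge_eq_of_mem hs hn huv hu.1 hv.1 hu.2 hv.2))

end design

lemma bddAbove_card_meeting (n s : ℕ) :
    BddAbove {m | ∃ H : LinearQuadSystem n, ∃ A : Finset (Fin n), A.card = s ∧
      (H.edges.filter (fun e => (e ∩ A).Nonempty)).card = m} :=
  ⟨(univ : Finset (Finset (Fin n))).card, by
    rintro _ ⟨H, A, -, rfl⟩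
    exact card_le_card (subset_univ _)⟩

lemma card_meeting_le_g (H : LinearQuadSystem n) {A : Finset (Fin n)} {k : ℕ}
    (hA : A.card = k - 1) : (H.edges.filter (fun e => (e ∩ A).Nonempty)).card ≤ g n k :=
  le_csSup (bddAbove_card_meeting n (k - 1)) ⟨H, A, hA, rfl⟩

lemma exists_card_meeting_eq_g {k : ℕ} (hkn : k - 1 ≤ n) :
    ∃ H : LinearQuadSystem n, ∃ A : Finset (Fin n), A.card = k - 1 ∧
      (H.edges.filter (fun e => (e ∩ A).Nonempty)).card = g n k := by
  obtain ⟨A, -, hA⟩ := exists_subset_card_eq (s := (univ : Finset (Fin n))) (n := k - 1)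
    (by rwa [card_univ, Fintype.card_fin])
  let H : LinearQuadSystem n := ⟨∅, by simp, by simp⟩
  have hmem := fun hne => Nat.sSup_mem hne (bddAbove_card_meeting n (k - 1))
  exact hmem ⟨_, H, A, hA, rfl⟩

lemma mul_le_g {s m : ℕ} (hs : 2 * s ≤ m) (hn : s + 3 * m ≤ n) : s * m ≤ g n (s + 1) := by
  have hsn : s ≤ n := by omega
  set A : Finset (Fin n) := univ.map (Fin.castLEEmb hsn) with hA
  have hcard : ((design hs hn).edges.filter (fun e => (e ∩ A).Nonempty)).card = s * m := by
    rw [filter_true_of_mem, design, card_image_of_injective _ (designEdge_injective hs hn),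
      card_univ, Fintype.card_prod, Fintype.card_fin, Fintype.card_fin]
    intro e he
    obtain ⟨p, -, rfl⟩ := mem_image.1 he
    refine ⟨Fin.castLEEmb hsn p.1, mem_inter.2 ⟨mem_image.2 ⟨0, mem_univ _, ?_⟩, ?_⟩⟩
    · exact Fin.ext rfl
    · exact mem_map_of_mem _ (mem_univ _)
  exact hcard ▸ card_meeting_le_g _ (by simp [hA])

lemma card_meeting_le (H : LinearQuadSystem n) (B : Finset (Fin n)) :
    (H.edges.filter (fun e => (e ∩ B).Nonempty)).card ≤ B.card * ((n - 1) / 3) := by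
  refine (card_le_card fun e he => ?_).trans
    (card_biUnion_le_card_mul B H.star _ fun v _ => H.card_star_le v)
  obtain ⟨he, v, hv⟩ := mem_filter.1 he
  rw [mem_inter] at hv
  exact mem_biUnion.2 ⟨v, hv.2, mem_star.2 ⟨he, hv.1⟩⟩

lemma degree_count_le {n s b : ℕ} (hn : 37 * s ^ 2 + 3 < n) (hb : b < s) :
    b * ((n - 1) / 3) + (s - b) * (1 + 4 * (4 * s - 1)) ≤ s * ((n - s) / 3) := by
  obtain ⟨c, rfl⟩ : ∃ c, s = b + 1 + c := ⟨s - (b + 1), by omega⟩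
  set s := b + 1 + c with hs
  have hD : 16 * s - 3 ≤ (n - 1) / 3 := by
    rcases Nat.lt_or_ge s 2 with h | h
    · have : s = 1 := by omega
      rw [this] at hn ⊢; omega
    · have : 2 * s ≤ s ^ 2 := by nlinarith
      omega
  have hlin : (s - 1) * ((n - 1) / 3) + (16 * s - 3) ≤ s * ((n - s) / 3) := by
    rcases Nat.lt_or_ge s 2 with h | h
    · have : s = 1 := by omega
      rw [this] at hn ⊢; omega
    · have h1 : 3 * ((n - 1) / 3) ≤ n - 1 := by omega
      have h2 : 2 * s ≤ s ^ 2 := by nlinarith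
      have h3 : n ≤ 3 * ((n - s) / 3) + s + 2 := by omega
      have h4 : 16 * s - 3 + 3 = 16 * s := by omega
      generalize (n - 1) / 3 = D at *
      generalize (n - s) / 3 = m at *
      generalize 16 * s - 3 = w at *
      obtain ⟨r, hr⟩ : ∃ r, s = r + 1 := ⟨s - 1, by omega⟩
      have h5 : 3 * D + 1 ≤ n := by omega
      clear_value s
      subst hr
      simp only [Nat.add_sub_cancel]
      nlinarith
  have hw : 1 + 4 * (4 * s - 1) = 16 * s - 3 := by omega
  rw [hw]
  have h6 : s - b = c + 1 := by omega
  have h7 : s - 1 = b + c := by omega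
  rw [h6]
  rw [h7] at hlin
  have := Nat.mul_le_mul_left c hD
  nlinarith

lemma card_edges_le_g {s : ℕ} (hn : 37 * s ^ 2 + 3 < n) (H : LinearQuadSystem n)
    (hH : ¬ ContainsMatching (s + 1) H) : H.edges.card ≤ g n (s + 1) := by
  set L : Finset (Fin n) := univ.filter fun v => 4 * s < (H.star v).card with hL
  obtain ⟨B, hBL, hB⟩ := exists_subset_card_eq (min_le_right s L.card)
  set E := H.edges.filter fun e => ¬ (e ∩ B).Nonempty with hE
  have hEB : ∀ e ∈ E, Disjoint e B := fun e he =>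
    disjoint_iff_inter_eq_empty.2 (not_nonempty_iff_eq_empty.1 (mem_filter.1 he).2)
  have hmatch : ∀ M ⊆ E, (M : Set (Finset (Fin n))).PairwiseDisjoint id →
      M.card ≤ s - B.card := by
    intro M hM hdisj
    by_contra! hlt
    obtain ⟨M', hM', hcard⟩ := exists_subset_card_eq (show s + 1 - B.card ≤ M.card by omega)
    refine hH (H.containsMatching_of_large_degree B (fun v hv => (mem_filter.1 (hBL hv)).2) M'
      ((hM'.trans hM).trans (filter_subset _ _)) (hdisj.subset (coe_subset.2 hM'))
      (fun e he => hEB e (hM (hM' he))) ?_)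
    omega
  have hsplit : (H.edges.filter fun e => (e ∩ B).Nonempty).card + E.card = H.edges.card :=
    card_filter_add_card_filter_not _
  rcases le_or_gt s L.card with hsL | hsL
  · have hBs : B.card = s := by omega
    have hE0 : E.card = 0 := by
      by_contra hne
      obtain ⟨e, he⟩ := card_pos.1 (Nat.pos_of_ne_zero hne)
      have := hmatch {e} (singleton_subset_iff.2 he) (by simp)
      rw [card_singleton] at this
      omega
    have := H.card_meeting_le_g (k := s + 1) hBs
    omega
  · have hBL' : B = L := eq_of_subset_of_card_le hBL (by omega)
    have hBs : B.card < s := by omega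
    have hEcard : E.card ≤ (s - B.card) * (1 + 4 * (4 * s - 1)) :=
      H.card_le_of_matching_bound (filter_subset _ _) hmatch fun e he v hv => by
        have hvL : v ∉ L := hBL' ▸ disjoint_left.1 (hEB e he) hv
        simp only [hL, mem_filter, mem_univ, true_and, not_lt] at hvL
        omega
    have hs2 : s ≤ s ^ 2 := Nat.le_self_pow two_ne_zero s
    have hg : s * ((n - s) / 3) ≤ g n (s + 1) := mul_le_g (by omega) (by omega)
    have := H.card_meeting_le B
    have := degree_count_le hn hBs
    omega

end LinearQuadSystem

/-- for `n > 37(k-1)² + 3`, `ex^lin_4(n, M_k) = g(n,k)`. -/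
theorem linear_turan_matching (n k : ℕ) (hn : 0 < n) (hk : 0 < k)
    (h : 37 * (k - 1) ^ 2 + 3 < n) :
    (∀ H : LinearQuadSystem n, ¬ ContainsMatching k H → H.edges.card ≤ g n k) ∧
    (∃ H : LinearQuadSystem n, ¬ ContainsMatching k H ∧ H.edges.card = g n k) := by
  constructor
  · intro H hH
    obtain ⟨s, rfl⟩ : ∃ s, k = s + 1 := ⟨k - 1, by omega⟩
    exact H.card_edges_le_g h hH
  · have hsq : k - 1 ≤ (k - 1) ^ 2 := Nat.le_self_pow two_ne_zero _
    obtain ⟨H, A, hA, hcard⟩ :=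
      LinearQuadSystem.exists_card_meeting_eq_g (n := n) (k := k) (by omega)
    exact ⟨H.restrict fun e => (e ∩ A).Nonempty,
      LinearQuadSystem.not_containsMatching_of_cover (A := A) (by omega)
        fun e he => (Finset.mem_filter.1 he).2, hcard⟩
end
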